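/- arXiv:1612.00242 — 6 statements merged into one kernel-verified Lean document; each statement's English description precedes it below -/
import Mathlib

section
/- The group G₂₉ = ⟨x,y | x² = y³ = ((xy)⁴(xy²)⁴(xy)²(xy²)³xy(xy²)²(xy)³(xy²)³(xy)²xy²)² = 1⟩ is large: it has a subgroup of finite index that admits a surjective homomorphism onto the free group of rank 2. -/
/-- The free product `ℤ/2 * ℤ/3` is realised as a quotient of the free group on two
generators; here we work with the free group `F` on generators `x, y` and impose the
relations `x² = y³ = W² = 1` all at once via `PresentedGroup`. -/
abbrev F : Type := FreeGroup (Fin 2)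

/-- The generator `x` (of order 2 in the quotient). -/
def x : F := FreeGroup.of 0

/-- The generator `y` (of order 3 in the quotient). -/
def y : F := FreeGroup.of 1

/-- The relators of the generalised triangle group of type (2,3,2) with word `W`. -/
def rels (W : F) : Set F := {x ^ 2, y ^ 3, W ^ 2}

/-- The generalised triangle group `⟨x, y | x² = y³ = W² = 1⟩`. -/
abbrev GT (W : F) : Type := PresentedGroup (rels W)

/-- The canonical projection from the free group to the generalised triangle group. -/
def mk (W : F) : F →* GT W := PresentedGroup.mk (rels W)

/-- The word `(xy)⁴(xy²)⁴(xy)²(xy²)³xy(xy²)²(xy)³(xy²)³(xy)²xy²` defining `G₂₉`. -/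
def W29 : F := (x*y)^4 * (x*y^2)^4 * (x*y)^2 * (x*y^2)^3 * (x*y) * (x*y^2)^2 *
  (x*y)^3 * (x*y^2)^3 * (x*y)^2 * (x*y^2)

section Monomial

variable {X K : Type*} [Group K]

/-- The action of the permutations of `X` on the power group `X → K` by permuting coordinates. -/
def permCoordAut (X K : Type*) [Group K] : Equiv.Perm X →* MulAut (X → K) where
  toFun σ :=
    { toFun := fun f p => f (σ⁻¹ p)
      invFun := fun f p => f (σ p)
      left_inv := fun f => by simp
      right_inv := fun f => by simp
      map_mul' := fun _ _ => rfl }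
  map_one' := rfl
  map_mul' _ _ := rfl

/-- The permutational wreath product of `K` by the permutations of `X`. -/
abbrev PermWreath (X K : Type*) [Group K] : Type _ :=
  (X → K) ⋊[permCoordAut X K] Equiv.Perm X

theorem PermWreath.left_mul_apply (a b : PermWreath X K) (p : X) :
    (a * b).left p = a.left p * b.left (a.right⁻¹ p) := by
  rw [SemidirectProduct.mul_left, Pi.mul_apply]
  rfl

/-- The subgroup of the elements of `G` that fix the point `p`, for a homomorphism from `G` to a
permutational wreath product. -/
def pointStabilizer {G : Type*} [Group G] (ρ : G →* PermWreath X K) (p : X) : Subgroup G :=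
  (MulAction.stabilizer (Equiv.Perm X) p).comap (SemidirectProduct.rightHom.comp ρ)

theorem mem_pointStabilizer {G : Type*} [Group G] {ρ : G →* PermWreath X K} {p : X} {g : G} :
    g ∈ pointStabilizer ρ p ↔ (ρ g).right⁻¹ p = p := by
  rw [Equiv.Perm.inv_eq_iff_eq, eq_comm]
  rfl

theorem finiteIndex_pointStabilizer [Finite X] {G : Type*} [Group G] (ρ : G →* PermWreath X K)
    (p : X) : (pointStabilizer ρ p).FiniteIndex := by
  rw [Subgroup.finiteIndex_iff, pointStabilizer, Subgroup.index_comap]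
  exact Subgroup.FiniteIndex.index_ne_zero

/-- The coordinate at `p`, a homomorphism on the stabilizer of `p`. -/
def pointCoordinate {G : Type*} [Group G] (ρ : G →* PermWreath X K) (p : X) :
    pointStabilizer ρ p →* K where
  toFun g := (ρ g).left p
  map_one' := by simp
  map_mul' g h := by
    rw [Subgroup.coe_mul, map_mul, PermWreath.left_mul_apply, mem_pointStabilizer.1 g.2]

end Monomial

section Labelled

variable {ι α X : Type*}

/-- The endpoint of the path that starts at `p` and reads the word `l`, in the graph whose edge
with name `i` leads from `p` to `step i p`. -/
def endpoint (step : ι → X → X) : List ι → X → X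
  | [], p => p
  | i :: l, p => endpoint step l (step i p)

/-- The concatenated edge labels along the path that starts at `p` and reads the word `l`. -/
def pathLabel (step : ι → X → X) (lab : ι → X → List α) : List ι → X → List α
  | [], _ => []
  | i :: l, p => lab i p ++ pathLabel step lab l (step i p)

/-- The wreath product elements given by a labelled permutation graph. -/
def edgeElement (σ : ι → Equiv.Perm X) (lab : ι → X → List (α × Bool)) (i : ι) :
    PermWreath X (FreeGroup α) :=
  ⟨fun p => FreeGroup.mk (lab i p), (σ i)⁻¹⟩

variable (σ : ι → Equiv.Perm X) (lab : ι → X → List (α × Bool))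

theorem right_inv_prod_edgeElement (l : List ι) (p : X) :
    ((l.map (edgeElement σ lab)).prod).right⁻¹ p = endpoint (fun i => σ i) l p := by
  induction l generalizing p with
  | nil => simp [endpoint]
  | cons i l ih =>
    rw [List.map_cons, List.prod_cons, SemidirectProduct.mul_right, mul_inv_rev,
      Equiv.Perm.mul_apply, ih]
    simp [endpoint, edgeElement]

theorem left_prod_edgeElement (l : List ι) (p : X) :
    ((l.map (edgeElement σ lab)).prod).left p =
      FreeGroup.mk (pathLabel (fun i => σ i) lab l p) := by
  induction l generalizing p with
  | nil => simp [pathLabel, FreeGroup.one_eq_mk]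
  | cons i l ih =>
    rw [List.map_cons, List.prod_cons, PermWreath.left_mul_apply, ih, pathLabel,
      ← FreeGroup.mul_mk]
    simp [edgeElement]

theorem prod_edgeElement_eq_one [DecidableEq α] {l : List ι}
    (h : ∀ p, endpoint (fun i => σ i) l p = p ∧
      FreeGroup.reduce (pathLabel (fun i => σ i) lab l p) = []) :
    (l.map (edgeElement σ lab)).prod = 1 := by
  ext p
  · rw [left_prod_edgeElement, SemidirectProduct.one_left, Pi.one_apply, FreeGroup.one_eq_mk]
    exact FreeGroup.reduce.exact ((h p).2.trans FreeGroup.reduce_nil.symm)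
  · rw [SemidirectProduct.one_right, Equiv.Perm.one_apply, ← Equiv.Perm.eq_inv_iff_eq,
      right_inv_prod_edgeElement, (h p).1]

end Labelled

namespace Cover

/-- The image of a point under the first generator. -/
def xStep : Fin 48 → Fin 48 :=
  ![4, 5, 6, 7, 0, 1, 2, 3, 14, 12, 15, 13, 9, 11, 8, 10, 24, 25, 26, 27, 28, 29, 30, 31,
    16, 17, 18, 19, 20, 21, 22, 23, 40, 41, 42, 43, 47, 45, 46, 44, 32, 33, 34, 35, 39, 37, 38, 36]

/-- The image of a point under the second generator. -/
def yStep : Fin 48 → Fin 48 :=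
  ![8, 9, 10, 11, 12, 13, 14, 15, 16, 17, 18, 19, 20, 21, 22, 23, 0, 1, 2, 3, 4, 5, 6, 7,
    32, 33, 34, 35, 36, 37, 38, 39, 44, 45, 46, 47, 40, 42, 41, 43, 28, 30, 29, 31, 24, 25, 26, 27]

/-- The permutations of the 48 points by which the two generators act. -/
def perm : Fin 2 → Equiv.Perm (Fin 48) :=
  ![⟨xStep, xStep, by decide +kernel, by decide +kernel⟩,
    ⟨yStep, yStep ∘ yStep, by decide +kernel, by decide +kernel⟩]

/-- The nontrivial edge labels: one letter each, on eight edges of either kind. -/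
def label : Fin 2 → Fin 48 → List (Fin 2 × Bool)
  | 0, 8 | 0, 9 | 1, 28 | 1, 29 => [(0, false)]
  | 0, 10 | 0, 11 | 1, 30 | 1, 31 => [(1, false)]
  | 0, 12 | 0, 14 | 1, 40 | 1, 42 => [(0, true)]
  | 0, 13 | 0, 15 | 1, 41 | 1, 43 => [(1, true)]
  | _, _ => []

/-- The letters of the word `W29`. -/
def relatorWord : List (Fin 2) :=
  let a := [0, 1]
  let b := [0, 1, 1]
  [a, a, a, a, b, b, b, b, a, a, b, b, b, a, b, b, a, a, a, b, b, b, a, a, b].flatten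

/-- The images of the two generators in the wreath product. -/
abbrev gen : Fin 2 → PermWreath (Fin 48) (FreeGroup (Fin 2)) := edgeElement perm label

theorem lift_W29 : FreeGroup.lift gen W29 = (relatorWord.map gen).prod := by
  simp [W29, relatorWord, x, y, pow_succ, mul_assoc]

theorem lift_rels : ∀ r ∈ rels W29, FreeGroup.lift gen r = 1 := by
  rintro r (rfl | rfl | rfl)
  · have h : ([0, 0].map gen).prod = 1 :=
      prod_edgeElement_eq_one perm label (by decide +kernel)
    simpa [x, pow_succ] using h
  · have h : ([1, 1, 1].map gen).prod = 1 :=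
      prod_edgeElement_eq_one perm label (by decide +kernel)
    simpa [y, pow_succ, mul_assoc] using h
  · have h : ((relatorWord ++ relatorWord).map gen).prod = 1 :=
      prod_edgeElement_eq_one perm label (by decide +kernel)
    rwa [List.map_append, List.prod_append, ← lift_W29, ← sq, ← map_pow] at h

/-- The homomorphism from the triangle group to the wreath product. -/
def hom : GT W29 →* PermWreath (Fin 48) (FreeGroup (Fin 2)) :=
  PresentedGroup.toGroup lift_rels

theorem hom_prod (l : List (Fin 2)) :
    hom (l.map PresentedGroup.of).prod = (l.map gen).prod := by
  rw [map_list_prod, List.map_map]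
  congr 2
  ext i : 1
  exact PresentedGroup.toGroup.of lift_rels

theorem mk_pathLabel_mem_range {l : List (Fin 2)} (h : endpoint (fun i => perm i) l 0 = 0) :
    FreeGroup.mk (pathLabel (fun i => perm i) label l 0) ∈ (pointCoordinate hom 0).range := by
  refine ⟨⟨(l.map PresentedGroup.of).prod, mem_pointStabilizer.2 ?_⟩, ?_⟩
  · rw [hom_prod, right_inv_prod_edgeElement, h]
  · exact (congrArg (fun m => m.left 0) (hom_prod l)).trans (left_prod_edgeElement perm label l 0)

theorem surjective_pointCoordinate : Function.Surjective (pointCoordinate hom 0) := by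
  rw [← MonoidHom.range_eq_top, eq_top_iff, ← FreeGroup.closure_range_of, Subgroup.closure_le]
  rintro _ ⟨i, rfl⟩
  have key : ∀ l : List (Fin 2), endpoint (fun i => perm i) l 0 = 0 →
      FreeGroup.reduce (pathLabel (fun i => perm i) label l 0) = [(i, true)] →
      FreeGroup.of i ∈ (pointCoordinate hom 0).range := fun l h₁ h₂ => by
    have h := mk_pathLabel_mem_range h₁
    rwa [← FreeGroup.reduce.self, h₂] at h
  fin_cases i
  · exact key [1, 1, 0, 1, 0, 1, 0, 1, 0] (by decide +kernel) (by decide +kernel)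
  · exact key [1, 1, 0, 1, 1, 0, 1, 1, 0, 1, 0, 1, 1, 0, 1, 0, 1, 1, 0, 1, 0, 1]
      (by decide +kernel) (by decide +kernel)

end Cover

theorem stmt_13 :
    ∃ H : Subgroup (GT W29), H.FiniteIndex ∧
      ∃ f : H →* FreeGroup (Fin 2), Function.Surjective f :=
  ⟨pointStabilizer Cover.hom 0, finiteIndex_pointStabilizer _ _,
    pointCoordinate Cover.hom 0, Cover.surjective_pointCoordinate⟩
end

section
/- The group G₆ = ⟨x,y | x² = y³ = ((xy)³(xy²)³xyxy²(xy)²xy²)² = 1⟩ is large: it has a subgroup of finite index that admits a surjective homomorphism onto the free group of rank 2. In particular, the large group G₃ = ⟨x,y | x² = y³ = ((xy)³xy²xy(xy²)²xyxy²)² = 1⟩ is a homomorphic image of G₆. -/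
/-- The word `(xy)³(xy²)³xyxy²(xy)²xy²` defining `G₆`. -/
def W6 : F := (x*y)^3 * (x*y^2)^3 * (x*y) * (x*y^2) * (x*y)^2 * (x*y^2)

/-- The word `(xy)³xy²xy(xy²)²xyxy²` defining `G₃`. -/
def W3 : F := (x*y)^3 * (x*y^2) * (x*y) * (x*y^2)^2 * (x*y) * (x*y^2)

open Equiv

/-- A group with a homomorphism to a permutational wreath product `K ≀ Perm ι` restricts, on the
stabiliser of a point `i`, to a homomorphism to `K` (the coordinate at `i`). If this hits a
generating set of `K`, we get a surjection from a finite-index subgroup onto `K`. -/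
theorem exists_finiteIndex_surjective_of_wreath {G K ι : Type*} [Group G] [Group K] [Finite ι]
    (Φ : G →* (ι → K) ⋊[mulAutArrow] Perm ι) (i : ι) (S : Set K) (hS : Subgroup.closure S = ⊤)
    (h : ∀ k ∈ S, ∃ g, (Φ g).right i = i ∧ (Φ g).left i = k) :
    ∃ H : Subgroup G, H.FiniteIndex ∧ ∃ f : H →* K, Function.Surjective f := by
  let P : Subgroup (Perm ι) := MulAction.stabilizer (Perm ι) i
  let H : Subgroup G := P.comap (SemidirectProduct.rightHom.comp Φ)
  have fixes : ∀ g : H, (Φ g).right i = i := fun g => g.2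
  let f : H →* K :=
    { toFun := fun g => (Φ g).left i
      map_one' := by simp
      map_mul' := fun a b => by
        have ha : (Φ a).right⁻¹ i = i := by rw [Perm.inv_eq_iff_eq]; exact (fixes a).symm
        rw [Subgroup.coe_mul, map_mul]
        change (Φ a).left i * (Φ b).left ((Φ a).right⁻¹ i) = _
        rw [ha] }
  have hH : H.FiniteIndex := ⟨by
    rw [Subgroup.index_comap]
    exact (Subgroup.instFiniteIndex_subgroupOf P _).index_ne_zero⟩
  refine ⟨H, hH, f, ?_⟩
  rw [← MonoidHom.range_eq_top, ← top_le_iff, ← hS, Subgroup.closure_le]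
  intro k hk
  obtain ⟨g, hg, hgk⟩ := h k hk
  exact ⟨⟨g, hg⟩, hgk⟩

/-- The right action of `x` on the 60 cosets of a subgroup of order 2 in `A₅ × ℤ/2`. -/
def xTable : Fin 60 → Fin 60 :=
  ![44, 57, 31, 46, 23, 50, 47, 55, 52, 42, 10, 14, 45, 34, 11, 43, 29, 56, 58, 49, 41, 21, 30, 4,
    59, 37, 35, 32, 51, 16, 22, 2, 27, 48, 13, 26, 54, 25, 38, 53, 40, 20, 9, 15, 0, 12, 3, 6, 33,
    19, 5, 28, 8, 39, 36, 7, 17, 1, 18, 24]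

/-- The permutation of the 60 cosets by `x` (its own inverse). -/
def xPerm : Perm (Fin 60) :=
  Function.Involutive.toPerm xTable (show ∀ i, xTable (xTable i) = i by decide +kernel)

/-- The permutation of the 60 cosets by the inverse of `y`: rotation of the consecutive triples. -/
def yPerm : Perm (Fin 60) where
  toFun i := if i.val % 3 = 0 then i + 2 else i - 1
  invFun i := if i.val % 3 = 2 then i - 2 else i + 1
  left_inv := by decide +kernel
  right_inv := by decide +kernel

/-- The labels of the edges traversed by `x`. -/
def xLabel (i : Fin 60) : F :=
  if i = 16 then FreeGroup.of 0 else if i = 29 then (FreeGroup.of 0)⁻¹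
  else if i = 33 then FreeGroup.of 1 else if i = 48 then (FreeGroup.of 1)⁻¹ else 1

/-- The images of `x` and `y` in the wreath product of a free group of rank 2 by `Perm (Fin 60)`. -/
def wreathGen : Fin 2 → (Fin 60 → F) ⋊[mulAutArrow] Perm (Fin 60) :=
  ![⟨xLabel, xPerm⟩, ⟨1, yPerm⟩]

theorem lift_wreathGen_eq_one : ∀ r ∈ rels W6, FreeGroup.lift wreathGen r = 1 := by
  rintro r (rfl | rfl | rfl) <;>
    exact SemidirectProduct.ext (funext (by decide +kernel)) (Equiv.ext (by decide +kernel))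

/-- The homomorphism from `G₆` to the wreath product determined by `wreathGen`. -/
def wreathHom : GT W6 →* (Fin 60 → F) ⋊[mulAutArrow] Perm (Fin 60) :=
  PresentedGroup.toGroup lift_wreathGen_eq_one

theorem wreathHom_mk (w : F) : wreathHom (mk W6 w) = FreeGroup.lift wreathGen w := rfl

theorem exists_wreathHom_eq_of (k : Fin 2) :
    ∃ g, (wreathHom g).right 16 = 16 ∧ (wreathHom g).left 16 = FreeGroup.of k := by
  fin_cases k
  · refine ⟨mk W6 ((x * y * x * y⁻¹) ^ 2 * (x * y)), ?_⟩
    rw [wreathHom_mk]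
    decide +kernel
  · refine ⟨mk W6 (y * (x * y) ^ 5 * (x * y⁻¹) ^ 4 * (x * y)), ?_⟩
    rw [wreathHom_mk]
    decide +kernel

/-- If `x² = y³ = 1`, then the square of the word `W₆` is a product of two conjugates of the inverse
square of `W₃`. -/
theorem word_sq_eq_conj_mul_conj {G : Type*} [Group G] {a b : G} (ha : a ^ 2 = 1)
    (hb : b ^ 3 = 1) (w : G)
    (hw : w = (a*b)^3 * (a*b^2) * (a*b) * (a*b^2)^2 * (a*b) * (a*b^2)) (g h : G)
    (hg : g = a*b*a*b⁻¹*a*b⁻¹*a*b⁻¹*a*b*a*b⁻¹) (hh : h = b*a*b⁻¹*a*b⁻¹*a*b*a*b⁻¹) :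
    ((a*b)^3 * (a*b^2)^3 * (a*b) * (a*b^2) * (a*b)^2 * (a*b^2)) ^ 2 =
      g * (w ^ 2)⁻¹ * g⁻¹ * (h * (w ^ 2)⁻¹ * h⁻¹) := by
  have a1 : a * a = 1 := by rw [← pow_two, ha]
  have a2 (z : G) : a * (a * z) = z := by rw [← mul_assoc, a1, one_mul]
  have b1 : b * (b * b) = 1 := by rw [← hb, pow_succ, pow_two, mul_assoc]
  have b2 (z : G) : b * (b * (b * z)) = z := by
    rw [← mul_assoc b b z, ← mul_assoc, b1, one_mul]
  have a3 : a⁻¹ = a := inv_eq_of_mul_eq_one_left a1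
  have b3 : b⁻¹ = b * b := inv_eq_of_mul_eq_one_right b1
  subst hw hg hh
  simp only [pow_succ, pow_zero, one_mul, mul_one, mul_inv_rev, mul_assoc, a2, a3, b1, b2, b3]

theorem mk_W3_eq_one : ∀ r ∈ rels W6, mk W3 r = 1 := by
  rintro r (rfl | rfl | rfl)
  · exact PresentedGroup.one_of_mem (by simp [rels])
  · exact PresentedGroup.one_of_mem (by simp [rels])
  · have hx : mk W3 x ^ 2 = 1 := by rw [← map_pow]; exact PresentedGroup.one_of_mem (by simp [rels])
    have hy : mk W3 y ^ 3 = 1 := by rw [← map_pow]; exact PresentedGroup.one_of_mem (by simp [rels])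
    have hW : mk W3 W3 ^ 2 = 1 := by rw [← map_pow]; exact PresentedGroup.one_of_mem (by simp [rels])
    have key := word_sq_eq_conj_mul_conj hx hy (mk W3 W3)
      (by simp only [← map_mul, ← map_pow]; rfl) _ _ rfl rfl
    simpa [W6, hW] using key

theorem exists_surjective_GT_W6_GT_W3 : ∃ f : GT W6 →* GT W3, Function.Surjective f := by
  refine ⟨QuotientGroup.lift _ (mk W3) (Subgroup.normalClosure_le_normal mk_W3_eq_one), ?_⟩
  exact QuotientGroup.lift_surjective_of_surjective _ _ (PresentedGroup.mk_surjective _) _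

theorem stmt_14 :
    (∃ H : Subgroup (GT W6), H.FiniteIndex ∧
      ∃ f : H →* FreeGroup (Fin 2), Function.Surjective f) ∧
    (∃ f : GT W6 →* GT W3, Function.Surjective f) := by
  refine ⟨?_, exists_surjective_GT_W6_GT_W3⟩
  refine exists_finiteIndex_surjective_of_wreath wreathHom 16 (Set.range FreeGroup.of)
    (FreeGroup.closure_range_of _) ?_
  rintro _ ⟨k, rfl⟩
  exact exists_wreathHom_eq_of k
end

section
/- The group G₁₁ = ⟨x,y | x² = y³ = ((xy)³(xy²)²)² = 1⟩ contains a normal subgroup of finite index that is isomorphic to ℤ³ (the free abelian group of rank 3). In particular G₁₁ is virtually abelian, hence has a solvable subgroup of finite index. -/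
/-- The word `(xy)³(xy²)²` defining `G₁₁`. -/
def W11 : F := (x*y)^3 * (x*y^2)^2

section TwoThreeGenerated

variable {G : Type*} [Group G] {s t : G}

theorem induction_of_closure_pair (hs : s ^ 2 = 1) (ht : t ^ 3 = 1)
    (hgen : Subgroup.closure {s, t} = ⊤) {P : G → Prop} (one : P 1)
    (left : ∀ g, P g → P (s * g)) (right : ∀ g, P g → P (t * g)) (g : G) : P g := by
  have hs' : s⁻¹ = s := inv_eq_of_mul_eq_one_right (by rw [← pow_two, hs])
  have ht' : t⁻¹ = t * t := inv_eq_of_mul_eq_one_right (by rw [← ht, pow_three])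
  have hg : g ∈ Subgroup.closure {s, t} := hgen ▸ Subgroup.mem_top g
  induction hg using Subgroup.closure_induction_left with
  | one => exact one
  | mul_left z hz g _ ih =>
    rcases hz with rfl | rfl
    · exact left g ih
    · exact right g ih
  | inv_mul_cancel z hz g _ ih =>
    rcases hz with rfl | rfl
    · exact hs'.symm ▸ left g ih
    · rw [ht', mul_assoc]
      exact right _ (right g ih)

open scoped Pointwise in
/-- The quotients of the triangle group `⟨s, t | s² = t³ = (st)⁴ = 1⟩` are finite. -/
theorem finite_of_triangle_two_three_four (hs : s ^ 2 = 1) (ht : t ^ 3 = 1)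
    (hst : (s * t) ^ 4 = 1) (hgen : Subgroup.closure {s, t} = ⊤) : Finite G := by
  have hss : s * s = 1 := by rw [← pow_two, hs]
  have hss' (g : G) : s * (s * g) = g := by rw [← mul_assoc, hss, one_mul]
  have ht' : t⁻¹ = t * t := inv_eq_of_mul_eq_one_right (by rw [← ht, pow_three])
  have htt (g : G) : t * (t * (t * g)) = g := by
    rw [← mul_assoc t t, ← ht', inv_mul_cancel_left]
  let Z := Subgroup.zpowers (s * t)
  have ha : s * t ∈ Z := Subgroup.mem_zpowers _
  have hfin : (Z : Set G).Finite := by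
    have : IsOfFinOrder (s * t) := isOfFinOrder_iff_pow_eq_one.2 ⟨4, by norm_num, hst⟩
    exact finite_zpowers.2 this
  let R : Set G := {1, t, t * t, s * t * t, t * s * t * t, t * t * s * t * t}
  have hS : (R * (Z : Set G)).Finite := Set.Finite.mul (by simp [R]) hfin
  have hsq : s * t * s * t = t * t * s * t * t * s := by
    have h : (s * t) ^ 2 = ((s * t) ^ 2)⁻¹ :=
      eq_inv_of_mul_eq_one_left (by rw [← pow_add, hst])
    have hs' : s⁻¹ = s := inv_eq_of_mul_eq_one_right hss
    simpa [pow_two, mul_assoc, hs', ht'] using h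
  have mem (r : G) (hr : r ∈ R) (w : G) (hw : w ∈ Z) : r * w ∈ R * (Z : Set G) :=
    Set.mul_mem_mul hr hw
  have huniv (g : G) : g ∈ R * (Z : Set G) := by
    refine induction_of_closure_pair hs ht hgen (P := fun g => g ∈ R * (Z : Set G))
      ?_ ?_ ?_ g
    · simpa using mem 1 (by simp [R]) 1 Z.one_mem
    · suffices h : ∀ r ∈ R, ∀ w ∈ Z, s * (r * w) ∈ R * (Z : Set G) by
        rintro _ ⟨r, hr, w, hw, rfl⟩
        exact h r hr w hw
      simp only [R, Set.mem_insert_iff, Set.mem_singleton_iff, forall_eq_or_imp, forall_eq]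
      refine ⟨?_, ?_, ?_, ?_, ?_, ?_⟩ <;> intro w hw
      · convert mem t (by simp [R]) ((s * t)⁻¹ * w) (Z.mul_mem (Z.inv_mem ha) hw) using 1
        simp [mul_assoc, inv_eq_of_mul_eq_one_right hss]
      · convert mem 1 (by simp [R]) (s * t * w) (Z.mul_mem ha hw) using 1
        simp [mul_assoc]
      · convert mem (s * t * t) (by simp [R]) w hw using 1
        simp [mul_assoc]
      · convert mem (t * t) (by simp [R]) w hw using 1
        simp [mul_assoc, hss']
      · convert mem (t * t * s * t * t) (by simp [R]) (s * t * w) (Z.mul_mem ha hw) using 1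
        have := congrArg (· * (t * w)) hsq
        simpa [mul_assoc] using this
      · convert mem (t * s * t * t) (by simp [R]) ((s * t)⁻¹ * w)
          (Z.mul_mem (Z.inv_mem ha) hw) using 1
        have := congrArg (fun g => s * g * s * w) hsq
        simp only [mul_assoc, hss', mul_inv_rev, inv_eq_of_mul_eq_one_right hss, ht'] at this ⊢
        rw [← this, htt]
    · suffices h : ∀ r ∈ R, ∀ w ∈ Z, t * (r * w) ∈ R * (Z : Set G) by
        rintro _ ⟨r, hr, w, hw, rfl⟩
        exact h r hr w hw
      simp only [R, Set.mem_insert_iff, Set.mem_singleton_iff, forall_eq_or_imp, forall_eq]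
      refine ⟨?_, ?_, ?_, ?_, ?_, ?_⟩ <;> intro w hw
      · convert mem t (by simp [R]) w hw using 1
        simp
      · convert mem (t * t) (by simp [R]) w hw using 1
        simp [mul_assoc]
      · convert mem 1 (by simp [R]) w hw using 1
        simp [mul_assoc, htt]
      · convert mem (t * s * t * t) (by simp [R]) w hw using 1
        simp [mul_assoc]
      · convert mem (t * t * s * t * t) (by simp [R]) w hw using 1
        simp [mul_assoc]
      · convert mem (s * t * t) (by simp [R]) w hw using 1
        simp [mul_assoc, htt]
  exact Set.finite_univ_iff.1 (hS.subset fun g _ => huniv g)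

theorem conj_left_pow_four (hs : s ^ 2 = 1) :
    s * (s * t) ^ 4 * s⁻¹ = t * (s * t) ^ 4 * t⁻¹ := by
  have hss : s * s = 1 := by rw [← pow_two, hs]
  have hss' (g : G) : s * (s * g) = g := by rw [← mul_assoc, hss, one_mul]
  simp [pow_succ, mul_assoc, hss', inv_eq_of_mul_eq_one_right hss]

theorem conj_right_conj_right (ht : t ^ 3 = 1) (g : G) :
    t * (t * g * t⁻¹) * t⁻¹ = t⁻¹ * g * t := by
  have ht' : t⁻¹ = t * t := inv_eq_of_mul_eq_one_right (by rw [← ht, pow_three])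
  have htt : t⁻¹ * t⁻¹ = t := by nth_rw 2 [ht']; simp
  calc t * (t * g * t⁻¹) * t⁻¹ = (t * t) * g * (t⁻¹ * t⁻¹) := by group
    _ = t⁻¹ * g * t := by rw [htt, ← ht']

/-- The relation `((st)³(st²)²)² = 1` says that the involution `tst⁻¹` inverts `(st)⁴`. -/
theorem conj_left_conj_pow_four (hs : s ^ 2 = 1) (ht : t ^ 3 = 1)
    (hW : ((s * t) ^ 3 * (s * t ^ 2) ^ 2) ^ 2 = 1) :
    s * (t⁻¹ * (s * t) ^ 4 * t) * s⁻¹ = (t⁻¹ * (s * t) ^ 4 * t)⁻¹ := by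
  have hs' : s⁻¹ = s := inv_eq_of_mul_eq_one_right (by rw [← pow_two, hs])
  have ht' : t ^ 2 = t⁻¹ := eq_inv_of_mul_eq_one_left (by rw [← pow_succ, ht])
  have htt (g : G) : t⁻¹ * (t⁻¹ * g) = t * g := by
    rw [← mul_assoc, ← mul_inv_rev, ← pow_two, ht', inv_inv]
  have h : (s * t) ^ 3 * (s * t ^ 2) ^ 2 = (s * t) ^ 4 * (t * s * t⁻¹) := by
    have : (s * t)⁻¹ * (s * t ^ 2) ^ 2 = t * s * t⁻¹ := by
      rw [ht', pow_two]
      simp [mul_assoc, htt]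
    rw [← this, pow_succ (s * t) 3]
    group
  rw [h, pow_two] at hW
  rw [eq_inv_iff_mul_eq_one]
  calc s * (t⁻¹ * (s * t) ^ 4 * t) * s⁻¹ * (t⁻¹ * (s * t) ^ 4 * t)
      = t⁻¹ * ((t * s * t⁻¹) * ((s * t) ^ 4 * (t * s⁻¹ * t⁻¹) * (s * t) ^ 4)) * t := by group
    _ = t⁻¹ * ((s * t) ^ 4)⁻¹ * (((s * t) ^ 4 * (t * s * t⁻¹)) * ((s * t) ^ 4 *
          (t * s * t⁻¹))) * (s * t) ^ 4 * t := by rw [hs']; group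
    _ = 1 := by rw [hW]; group

end TwoThreeGenerated

/-- The action of `G₁₁` on `ℤ³` by rigid motions: the image of `x`. -/
def motionX : Equiv.Perm (ℤ × ℤ × ℤ) where
  toFun p := (p.2.1 + 1, p.1 - 1, -p.2.2)
  invFun p := (p.2.1 + 1, p.1 - 1, -p.2.2)
  left_inv p := by simp
  right_inv p := by simp

/-- The action of `G₁₁` on `ℤ³` by rigid motions: the image of `y`. -/
def motionY : Equiv.Perm (ℤ × ℤ × ℤ) where
  toFun p := (p.2.2, p.1, p.2.1)
  invFun p := (p.2.1, p.2.2, p.1)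
  left_inv _ := rfl
  right_inv _ := rfl

theorem motionX_apply (a b c : ℤ) : motionX (a, b, c) = (b + 1, a - 1, -c) := rfl

theorem motionY_apply (a b c : ℤ) : motionY (a, b, c) = (c, a, b) := rfl

theorem motionY_symm_apply (a b c : ℤ) : motionY.symm (a, b, c) = (b, c, a) := rfl

theorem motion_pow_four : (motionX * motionY) ^ 4 = Equiv.addRight ((4, 0, 0) : ℤ × ℤ × ℤ) := by
  ext ⟨a, b, c⟩ : 1
  simp [pow_succ, motionX_apply, motionY_apply]
  ring

/-- The representation of `G₁₁` by rigid motions of `ℤ³`. -/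
def motion : GT W11 →* Equiv.Perm (ℤ × ℤ × ℤ) :=
  PresentedGroup.toGroup (f := ![motionX, motionY]) <| by
    rintro r (rfl | rfl | rfl) <;> ext ⟨a, b, c⟩ : 1 <;>
      simp [W11, x, y, pow_succ, motionX_apply, motionY_apply]

section Structure

local notation "s" => mk W11 x
local notation "t" => mk W11 y

theorem mk_x_sq : s ^ 2 = 1 := by
  rw [← map_pow]
  exact PresentedGroup.one_of_mem (by simp [rels])

theorem mk_y_cube : t ^ 3 = 1 := by
  rw [← map_pow]
  exact PresentedGroup.one_of_mem (by simp [rels])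

theorem mk_relator_sq : ((s * t) ^ 3 * (s * t ^ 2) ^ 2) ^ 2 = 1 := by
  simp only [← map_pow, ← map_mul]
  exact PresentedGroup.one_of_mem (by simp [rels, W11])

theorem closure_mk : Subgroup.closure {s, t} = ⊤ := by
  rw [← PresentedGroup.closure_range_of (rels W11)]
  congr 1
  ext g
  simp [Fin.exists_fin_two, PresentedGroup.of, mk, x, y, eq_comm]

theorem motion_mk_x : motion s = motionX := PresentedGroup.toGroup.of _

theorem motion_mk_y : motion t = motionY := PresentedGroup.toGroup.of _

/-- The three elements of `G₁₁` acting on `ℤ³` as translations along the coordinate axes. -/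
def translation : Fin 3 → GT W11 :=
  ![(s * t) ^ 4, t * (s * t) ^ 4 * t⁻¹, t⁻¹ * (s * t) ^ 4 * t]

local notation "u" => translation

theorem conj_y_translation (i : Fin 3) : t * u i * t⁻¹ = u (i + 1) := by
  fin_cases i
  · rfl
  · exact conj_right_conj_right mk_y_cube _
  · change t * (t⁻¹ * (s * t) ^ 4 * t) * t⁻¹ = (s * t) ^ 4
    group

theorem conj_x_translation_zero : s * u 0 * s⁻¹ = u 1 := conj_left_pow_four mk_x_sq

theorem conj_x_translation_one : s * u 1 * s⁻¹ = u 0 := by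
  have hs' : s⁻¹ = s := inv_eq_of_mul_eq_one_right (by rw [← pow_two, mk_x_sq])
  rw [← conj_x_translation_zero, hs']
  simp only [mul_assoc, ← pow_two, mk_x_sq]
  simp only [← mul_assoc, ← pow_two, mk_x_sq, one_mul, mul_one]

theorem conj_x_translation_two : s * u 2 * s⁻¹ = (u 2)⁻¹ :=
  conj_left_conj_pow_four mk_x_sq mk_y_cube mk_relator_sq

theorem commute_translation_zero (i : Fin 3) : Commute (u 0) (u i) := by
  have h₁ : MulAut.conj (s * t) (u 1) = (u 2)⁻¹ := by
    rw [map_mul, MulAut.mul_apply, MulAut.conj_apply t, conj_y_translation]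
    exact conj_x_translation_two
  have h₂ : MulAut.conj (s * t) (u 2) = u 1 := by
    rw [map_mul, MulAut.mul_apply, MulAut.conj_apply t, conj_y_translation]
    exact conj_x_translation_zero
  have key (g : GT W11) (hg : (MulAut.conj (s * t) ^ 4) g = g) : Commute (u 0) g := by
    rw [← map_pow, MulAut.conj_apply, mul_inv_eq_iff_eq_mul] at hg
    exact hg
  match i with
  | 0 => exact Commute.refl _
  | 1 => exact key _ (by
      simp only [pow_succ, pow_zero, one_mul, MulAut.mul_apply, map_inv, h₁, h₂, inv_inv])
  | 2 => exact key _ (by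
      simp only [pow_succ, pow_zero, one_mul, MulAut.mul_apply, map_inv, h₁, h₂, inv_inv])

theorem commute_translation (i j : Fin 3) : Commute (u i) (u j) := by
  have step (i j : Fin 3) (h : Commute (u i) (u j)) : Commute (u (i + 1)) (u (j + 1)) := by
    rw [← conj_y_translation, ← conj_y_translation]
    exact h.map (MulAut.conj t)
  fin_cases i
  · exact commute_translation_zero j
  · simpa using step 0 (j - 1) (commute_translation_zero _)
  · simpa using step 1 (j - 1) (by simpa using step 0 (j - 1 - 1) (commute_translation_zero _))

/-- The embedding of the translation lattice in `G₁₁`. -/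
def latticeHom : Multiplicative (Fin 3 → ℤ) →* GT W11 where
  toFun v := u 0 ^ v.toAdd 0 * u 1 ^ v.toAdd 1 * u 2 ^ v.toAdd 2
  map_one' := by simp
  map_mul' v w := by
    have h (i j : Fin 3) (m n : ℤ) := ((commute_translation i j).zpow_zpow m n).eq
    simp only [toAdd_mul, Pi.add_apply, zpow_add, mul_assoc]
    congr 1
    rw [← mul_assoc (u 2 ^ _) (u 0 ^ _), h 2 0, mul_assoc, ← mul_assoc (u 1 ^ v.toAdd 1) (u 0 ^ _),
      h 1 0, mul_assoc, ← mul_assoc (u 2 ^ _) (u 1 ^ _), h 2 1]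
    simp only [mul_assoc]

theorem latticeHom_apply (v : Multiplicative (Fin 3 → ℤ)) :
    latticeHom v = u 0 ^ v.toAdd 0 * u 1 ^ v.toAdd 1 * u 2 ^ v.toAdd 2 := rfl

theorem motion_translation_zero : motion (u 0) = Equiv.addRight ((4, 0, 0) : ℤ × ℤ × ℤ) := by
  simp [translation, motion_mk_x, motion_mk_y, motion_pow_four]

theorem motion_translation_one : motion (u 1) = Equiv.addRight ((0, 4, 0) : ℤ × ℤ × ℤ) := by
  ext ⟨a, b, c⟩ : 1
  simp [translation, motion_mk_x, motion_mk_y, motion_pow_four, motionY_apply,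
    motionY_symm_apply, Equiv.Perm.inv_def]

theorem motion_translation_two : motion (u 2) = Equiv.addRight ((0, 0, 4) : ℤ × ℤ × ℤ) := by
  ext ⟨a, b, c⟩ : 1
  simp [translation, motion_mk_x, motion_mk_y, motion_pow_four, motionY_apply,
    motionY_symm_apply, Equiv.Perm.inv_def]

theorem latticeHom_injective : Function.Injective latticeHom := by
  rw [injective_iff_map_eq_one]
  intro v hv
  have h := congrArg (fun g => motion g (0, 0, 0)) hv
  simp [latticeHom_apply, motion_translation_zero, motion_translation_one,
    motion_translation_two] at h
  ext i
  fin_cases i <;> simp [h]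

theorem translation_mem_range (i : Fin 3) : u i ∈ latticeHom.range := by
  refine ⟨Multiplicative.ofAdd (Pi.single i 1), ?_⟩
  fin_cases i <;> simp [latticeHom_apply]

theorem conj_mem_range_latticeHom {k : GT W11}
    (hk : ∀ i, k * u i * k⁻¹ ∈ latticeHom.range) {g : GT W11} (hg : g ∈ latticeHom.range) :
    k * g * k⁻¹ ∈ latticeHom.range := by
  obtain ⟨v, rfl⟩ := hg
  simp only [← MulAut.conj_apply, latticeHom_apply, map_mul, map_zpow] at hk ⊢
  exact mul_mem (mul_mem (zpow_mem (hk 0) _) (zpow_mem (hk 1) _)) (zpow_mem (hk 2) _)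

theorem normal_range_latticeHom : latticeHom.range.Normal := by
  refine ⟨fun h hh g => ?_⟩
  refine induction_of_closure_pair mk_x_sq mk_y_cube closure_mk
    (P := fun g => g * h * g⁻¹ ∈ latticeHom.range) (by simpa using hh) ?_ ?_ g
  · intro g hg
    have : ∀ i, s * u i * s⁻¹ ∈ latticeHom.range := by
      intro i
      fin_cases i
      · exact conj_x_translation_zero ▸ translation_mem_range 1
      · exact conj_x_translation_one ▸ translation_mem_range 0
      · exact conj_x_translation_two ▸ inv_mem (translation_mem_range 2)
    simpa [mul_assoc] using conj_mem_range_latticeHom this hg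
  · intro g hg
    have : ∀ i, t * u i * t⁻¹ ∈ latticeHom.range := fun i =>
      conj_y_translation i ▸ translation_mem_range _
    simpa [mul_assoc] using conj_mem_range_latticeHom this hg

theorem finiteIndex_range_latticeHom : latticeHom.range.FiniteIndex := by
  have := normal_range_latticeHom
  let π := QuotientGroup.mk' latticeHom.range
  have hπ : Function.Surjective π := QuotientGroup.mk'_surjective _
  have : Finite (GT W11 ⧸ latticeHom.range) := by
    have hs : π s ^ 2 = 1 := by rw [← map_pow, mk_x_sq, map_one]
    have ht : π t ^ 3 = 1 := by rw [← map_pow, mk_y_cube, map_one]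
    refine finite_of_triangle_two_three_four hs ht ?_ ?_
    · rw [← map_mul, ← map_pow]
      exact (QuotientGroup.eq_one_iff _).2 (translation_mem_range 0)
    · rw [← Set.image_pair, ← MonoidHom.map_closure, closure_mk,
        Subgroup.map_top_of_surjective _ hπ]
  exact Subgroup.finiteIndex_of_finite_quotient

end Structure

theorem stmt_15 :
    (∃ H : Subgroup (GT W11), H.Normal ∧ H.FiniteIndex ∧
      Nonempty (H ≃* Multiplicative (Fin 3 → ℤ))) ∧
    (∃ H : Subgroup (GT W11), H.FiniteIndex ∧ ∀ a b : H, a * b = b * a) ∧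
    (∃ H : Subgroup (GT W11), H.FiniteIndex ∧ IsSolvable H) := by
  have e := (MonoidHom.ofInjective latticeHom_injective).symm
  have comm (a b : latticeHom.range) : a * b = b * a :=
    e.injective (by rw [map_mul, map_mul, mul_comm])
  exact ⟨⟨_, normal_range_latticeHom, finiteIndex_range_latticeHom, ⟨e⟩⟩,
    ⟨_, finiteIndex_range_latticeHom, comm⟩,
    ⟨_, finiteIndex_range_latticeHom, Group.isSolvable_of_comm comm⟩⟩
end

section
/- The groups G₁ = ⟨x,y | x² = y³ = (xy)² = 1⟩, G₂ = ⟨x,y | x² = y³ = ((xy)²xy²xyxy²)² = 1⟩ and G₄ = ⟨x,y | x² = y³ = ((xy)²xy²)² = 1⟩ are finite, of orders 6, 720 and 48 respectively. -/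
/-- The word `xy` defining `G₁`. -/
def W1 : F := x*y

/-- The word `(xy)²xy²xyxy²` defining `G₂`. -/
def W2 : F := (x*y)^2 * (x*y^2) * (x*y) * (x*y^2)

/-- The word `(xy)²xy²` defining `G₄`. -/
def W4 : F := (x*y)^2 * (x*y^2)

/-! Each group `GT W` is enumerated by the left cosets of the cyclic subgroup generated by `t = xy`.
The cosets are grouped into orbits of `y`, so that every element of the group has the form
`y ^ e * s i * t ^ k`, where `s i` represents the `i`-th orbit. -/

namespace GTEnum

section Representatives

variable {G : Type*} [Group G] {N : ℕ}

/-- The element `b ^ e * s i * t ^ k`. -/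
def rep (b t : G) (s : Fin N → G) (i : Fin N) (e : Fin 3) (k : ℤ) : G :=
  b ^ (e : ℕ) * s i * t ^ k

theorem mul_rep {b : G} (hb : b ^ 3 = 1) (t : G) (s : Fin N → G) (i : Fin N) (e : Fin 3) (k : ℤ) :
    b * rep b t s i e k = rep b t s i (e + 1) k := by
  have h : b ^ ((e + 1 : Fin 3) : ℕ) = b * b ^ (e : ℕ) := by
    fin_cases e
    · simp
    · simp [pow_two]
    · simpa [pow_succ', mul_assoc] using hb.symm
  simp only [rep, h, mul_assoc]

/-- Multiplication by `a` exchanges the cosets labelled `(i, e)` and `(j, f)`, with weight `w`. -/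
abbrev Edge (φ : Fin N → Fin 3 → ℤ → G) (a : G) (i : Fin N) (e : Fin 3) (j : Fin N) (f : Fin 3)
    (w : ℤ) : Prop :=
  (∀ k, a * φ i e k = φ j f (k + w)) ∧ ∀ k, a * φ j f k = φ i e (k + -w)

theorem edge_of_forall {φ : Fin N → Fin 3 → ℤ → G} {a : G} (ha : a ^ 2 = 1) {i j : Fin N}
    {e f : Fin 3} {w : ℤ} (h : ∀ k, a * φ i e k = φ j f (k + w)) : Edge φ a i e j f w := by
  refine ⟨h, fun k => ?_⟩
  have := h (k + -w)
  rw [neg_add_cancel_right] at this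
  rw [← this, ← mul_assoc, ← pow_two, ha, one_mul]

theorem edge_of_rep_eq {a b t : G} (ha : a ^ 2 = 1) {s : Fin N → G} {i j : Fin N} {e f : Fin 3}
    {w : ℤ} (h : a * rep b t s i e 0 = rep b t s j f w) : Edge (rep b t s) a i e j f w := by
  refine edge_of_forall ha fun k => ?_
  simp only [rep, zpow_zero, mul_one] at h ⊢
  rw [← mul_assoc, h, mul_assoc, ← zpow_add, add_comm w]

theorem rotate_sq_eq_one {a c g : G} (h : (a * (c * g)) ^ 2 = 1) : (g * (a * c)) ^ 2 = 1 := by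
  rw [← mul_assoc, pow_two, mul_assoc, mul_eq_one_comm, mul_assoc] at h
  simpa only [pow_two, mul_assoc] using h

theorem mul_eq_of_sq_eq_one {a v : G} (ha : a ^ 2 = 1) (h : (a * v) ^ 2 = 1) (g : G) :
    a * g = v * (a * (v * g)) := by
  rw [pow_two] at ha h
  rw [mul_assoc] at h
  have h' := mul_left_cancel (ha.trans h.symm)
  calc a * g = v * (a * v) * g := by rw [← h']
    _ = v * (a * (v * g)) := by simp only [mul_assoc]

theorem pow_eq_one_of_rep_eq {b t : G} {s : Fin N → G} {i : Fin N} {e : Fin 3} {k l : ℤ}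
    (h : rep b t s i e k = rep b t s i e l) (n : ℕ) (hn : k - l = n) : t ^ n = 1 := by
  rw [rep, rep, mul_left_cancel_iff] at h
  rw [← zpow_natCast, ← hn, zpow_sub, h, mul_inv_cancel]

end Representatives

theorem mk_x_sq (W : F) : mk W x ^ 2 = 1 := by
  rw [← map_pow]
  exact PresentedGroup.one_of_mem (by simp [rels])

theorem mk_y_pow_three (W : F) : mk W y ^ 3 = 1 := by
  rw [← map_pow]
  exact PresentedGroup.one_of_mem (by simp [rels])

theorem mk_word_sq {W v : F} (h : W = v) : mk W v ^ 2 = 1 := by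
  subst h
  rw [← map_pow]
  exact PresentedGroup.one_of_mem (by simp [rels])

section Action

variable {N m : ℕ}

/-- The permutation of the labels of the group elements induced by `y`. -/
def yPerm (N m : ℕ) : Equiv.Perm (Fin N × Fin 3 × ZMod m) where
  toFun p := (p.1, p.2.1 + 1, p.2.2)
  invFun p := (p.1, p.2.1 - 1, p.2.2)
  left_inv p := by simp
  right_inv p := by simp

/-- The map on labels induced by `x`, read off from a weighted coset table. -/
def xMap (m : ℕ) (T : Fin N → Fin 3 → Fin N × Fin 3 × ℤ) (p : Fin N × Fin 3 × ZMod m) :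
    Fin N × Fin 3 × ZMod m :=
  ((T p.1 p.2.1).1, (T p.1 p.2.1).2.1, p.2.2 + ((T p.1 p.2.1).2.2 : ℤ))

/-- A weighted coset table describes the group exactly when its entries hold in the group and the
relators act trivially on the labels. -/
theorem finite_and_card {W : F} [NeZero N] [NeZero m] (T : Fin N → Fin 3 → Fin N × Fin 3 × ℤ)
    (s : Fin N → GT W) (ht : (mk W x * mk W y) ^ m = 1)
    (hT : ∀ i e, Edge (rep (mk W y) (mk W x * mk W y) s) (mk W x) i e
      (T i e).1 (T i e).2.1 (T i e).2.2)
    (hT01 : T 0 1 = (0, 0, 1)) (hconn : ∀ j ≠ 0, ∃ i < j, ∃ e, (T i e).1 = j)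
    (hx : Function.Involutive (xMap m T))
    (hW : FreeGroup.lift ![hx.toPerm, yPerm N m] W ^ 2 = 1) :
    Finite (GT W) ∧ Nat.card (GT W) = N * (3 * m) := by
  have hb : mk W y ^ 3 = 1 := mk_y_pow_three W
  set a := mk W x
  set b := mk W y
  set t := a * b
  let φ : Fin N × Fin 3 × ZMod m → GT W := fun p => rep b t s p.1 p.2.1 p.2.2.val
  have hφ (i e) (n : ℤ) : φ (i, e, n) = rep b t s i e n := by
    have : t ^ ((n : ZMod m).val : ℤ) = t ^ n := by
      rw [ZMod.val_intCast, ← zpow_mod_orderOf, Int.emod_emod_of_dvd, zpow_mod_orderOf]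
      exact_mod_cast orderOf_dvd_of_pow_eq_one ht
    simp only [φ, rep, this]
  let X := hx.toPerm
  let Y := yPerm N m
  have hrels : ∀ r ∈ rels W, FreeGroup.lift ![X, Y] r = 1 := by
    rintro r (rfl | rfl | rfl)
    · ext1 p
      simpa [x, X, pow_two] using hx p
    · rw [y, map_pow, FreeGroup.lift_apply_of]
      ext1 ⟨i, e, k⟩
      simp [pow_succ, Y, yPerm, add_assoc]
    · rw [map_pow]
      exact hW
  let f : GT W →* Equiv.Perm (Fin N × Fin 3 × ZMod m) := PresentedGroup.toGroup hrels
  have hfa : f a = X := by exact PresentedGroup.toGroup.of hrels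
  have hfb : f b = Y := by exact PresentedGroup.toGroup.of hrels
  have hφX (p) : φ (X p) = a * φ p := by
    obtain ⟨i, e, k⟩ := p
    obtain ⟨n, rfl⟩ := ZMod.intCast_surjective k
    have := (hT i e).1 n
    rw [← hφ, ← hφ] at this
    rw [this]
    simp [X, xMap]
  have hφY (p) : φ (Y p) = b * φ p := (mul_rep hb _ _ _ _ _).symm
  have hφf (g : GT W) : ∀ p, φ (f g p) = g * φ p := by
    let H : Subgroup (GT W) :=
      { carrier := {g | ∀ p, φ (f g p) = g * φ p}
        one_mem' := by simp
        mul_mem' := fun hg hh p => by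
          rw [map_mul, Equiv.Perm.mul_apply, hg, hh, mul_assoc]
        inv_mem' := fun {g} hg p => by
          rw [eq_inv_mul_iff_mul_eq, ← hg, map_inv, ← Equiv.Perm.mul_apply,
            mul_inv_cancel, Equiv.Perm.one_apply] }
    refine PresentedGroup.generated_by _ H (Fin.forall_fin_two.2 ⟨fun p => ?_, fun p => ?_⟩) g
    · exact (congrArg (fun σ : Equiv.Perm _ => φ (σ p)) hfa).trans (hφX p)
    · exact (congrArg (fun σ : Equiv.Perm _ => φ (σ p)) hfb).trans (hφY p)
  have hinj : Function.Injective fun g => f g (0, 0, 0) := by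
    intro g h hgh
    have := congrArg φ hgh
    simpa [hφf] using this
  have hsurj : Function.Surjective fun g => f g (0, 0, 0) := by
    let S := {p | ∃ g, f g (0, 0, 0) = p}
    have hSX {p} (hp : p ∈ S) : X p ∈ S := by
      obtain ⟨g, rfl⟩ := hp
      exact ⟨a * g, by rw [map_mul, hfa]; rfl⟩
    have hSY {p} (hp : p ∈ S) : Y p ∈ S := by
      obtain ⟨g, rfl⟩ := hp
      exact ⟨b * g, by rw [map_mul, hfb]; rfl⟩
    have hSe {i e k} (hp : (i, e, k) ∈ S) (e') : (i, e', k) ∈ S := by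
      have h1 := hSY hp
      have h2 := hSY h1
      simp only [Y, yPerm, Equiv.coe_fn_mk] at h1 h2
      fin_cases e <;> fin_cases e' <;> assumption
    have hS0 (n : ℕ) : (0, 0, (n : ZMod m)) ∈ S := by
      induction n with
      | zero => exact ⟨1, by simp⟩
      | succ n ih => simpa [X, xMap, hT01] using hSX (hSe ih 1)
    have hS (i) : ∀ e k, (i, e, k) ∈ S := by
      induction i using WellFoundedLT.induction with
      | ind j ih =>
        intro e k
        by_cases hj : j = 0
        · subst hj
          exact hSe (e := 0) (by simpa using hS0 k.val) e
        · obtain ⟨i, hij, e', rfl⟩ := hconn j hj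
          have := hSX (ih i hij e' (k - ((T i e').2.2 : ℤ)))
          simp only [X, xMap, Function.Involutive.coe_toPerm, sub_add_cancel] at this
          exact hSe this e
    exact fun p => hS p.1 p.2.1 p.2.2
  refine ⟨.of_injective _ hinj, ?_⟩
  rw [Nat.card_congr (.ofBijective _ ⟨hinj, hsurj⟩)]
  simp

end Action

/-- The coset table of `GT W1`. -/
def table1 : Fin 1 → Fin 3 → Fin 1 × Fin 3 × ℤ :=
  ![![(0, 1, -1), (0, 0, 1), (0, 2, -1)]]

/-- The coset table of `GT W2`. -/
def table2 : Fin 12 → Fin 3 → Fin 12 × Fin 3 × ℤ :=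
  ![![(0, 1, -1), (0, 0, 1), (1, 0, 0)],
    ![(0, 2, 0), (2, 0, 0), (3, 0, 0)],
    ![(1, 1, 0), (4, 0, 0), (5, 0, 0)],
    ![(1, 2, 0), (6, 0, 0), (7, 0, 0)],
    ![(2, 1, 0), (8, 0, 0), (9, 0, 0)],
    ![(2, 2, 0), (6, 2, -3), (6, 1, -5)],
    ![(3, 1, 0), (5, 2, 5), (5, 1, 3)],
    ![(3, 2, 0), (9, 1, 2), (10, 0, 0)],
    ![(4, 1, 0), (10, 2, -9), (10, 1, -7)],
    ![(4, 2, 0), (7, 1, -2), (11, 0, 0)],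
    ![(7, 2, 0), (8, 2, 7), (8, 1, 9)],
    ![(9, 2, 0), (11, 2, -9), (11, 1, 9)]]

/-- The coset table of `GT W4`. -/
def table4 : Fin 2 → Fin 3 → Fin 2 × Fin 3 × ℤ :=
  ![![(0, 1, -1), (0, 0, 1), (1, 0, 0)],
    ![(0, 2, 0), (1, 2, -3), (1, 1, 3)]]

section Enumeration

variable {G : Type*} [Group G]

theorem exists_edges_table1 {a b t : G} (ht : t = a * b) (ha : a ^ 2 = 1) (hb : b ^ 3 = 1)
    (hW : (a * b) ^ 2 = 1) :
    ∃ s : Fin 1 → G, ∀ i e, Edge (rep b t s) a i e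
      (table1 i e).1 (table1 i e).2.1 (table1 i e).2.2 := by
  refine ⟨fun _ => 1, ?_⟩
  have hbφ := mul_rep hb t fun _ : Fin 1 => 1
  have e0 : Edge (rep b t fun _ : Fin 1 => 1) a 0 1 0 0 1 := edge_of_rep_eq ha (by simp [rep, ht])
  generalize rep b t (fun _ : Fin 1 => 1) = φ at *
  have e1 : Edge φ a 0 2 0 2 (-1) := edge_of_forall ha fun k => by
    rw [mul_eq_of_sq_eq_one ha hW]
    simp [hbφ, e0]
  intro i e
  fin_cases i
  fin_cases e
  exacts [⟨e0.2, by simpa [table1] using e0.1⟩, e0, e1]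

theorem exists_edges_table4 {a b t : G} (ht : t = a * b) (ha : a ^ 2 = 1) (hb : b ^ 3 = 1)
    (hW : ((a * b) ^ 2 * (a * b ^ 2)) ^ 2 = 1) :
    ∃ s : Fin 2 → G, t ^ 8 = 1 ∧ ∀ i e, Edge (rep b t s) a i e
      (table4 i e).1 (table4 i e).2.1 (table4 i e).2.2 := by
  have r0 : (a * (b * (a * (b * (a * (b ^ 2)))))) ^ 2 = 1 := by
    simpa only [pow_two, mul_assoc] using hW
  have r1 : (a * (b * (a * (b ^ 2 * (a * (b)))))) ^ 2 = 1 := by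
    simpa only [mul_assoc] using rotate_sq_eq_one r0
  have r2 : (a * (b ^ 2 * (a * (b * (a * (b)))))) ^ 2 = 1 := by
    simpa only [mul_assoc] using rotate_sq_eq_one r1
  obtain ⟨s0, h0⟩ : ∃ g : G, g = 1 := ⟨_, rfl⟩
  obtain ⟨s1, h1⟩ : ∃ g, g = a * (b ^ 2 * s0) := ⟨_, rfl⟩
  refine ⟨![s0, s1], ?_⟩
  generalize hs : (![s0, s1] : Fin 2 → G) = s
  have e0 : Edge (rep b t s) a 0 1 0 0 1 := edge_of_rep_eq ha (by simp [rep, ← hs, ht, h0])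
  have e1 : Edge (rep b t s) a 0 2 1 0 0 := edge_of_rep_eq ha (by simp [rep, ← hs, h1])
  have hbφ := mul_rep hb t s
  have ht1 {i e k l} := pow_eq_one_of_rep_eq (b := b) (t := t) (s := s) (i := i) (e := e) (k := k) (l := l)
  generalize rep b t s = φ at *
  have e2 : Edge φ a 1 2 1 1 3 := edge_of_forall ha fun k => by
    rw [mul_eq_of_sq_eq_one ha r1]
    simp [pow_two, mul_assoc, hbφ, add_assoc, e0, e1]
  refine ⟨?_, fun i e => ?_⟩
  · have h := mul_eq_of_sq_eq_one ha r0 (φ 0 1 0)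
    simp [pow_two, mul_assoc, hbφ, e0, e1, e2] at h
    exact ht1 h 8 (by norm_num)
  · fin_cases i <;> fin_cases e <;> simp [Edge, table4, e0, e1, e2]

theorem exists_edges_table2 {a b t : G} (ht : t = a * b) (ha : a ^ 2 = 1) (hb : b ^ 3 = 1)
    (hW : ((a * b) ^ 2 * (a * b ^ 2) * (a * b) * (a * b ^ 2)) ^ 2 = 1) :
    ∃ s : Fin 12 → G, t ^ 20 = 1 ∧ ∀ i e, Edge (rep b t s) a i e
      (table2 i e).1 (table2 i e).2.1 (table2 i e).2.2 := by
  have r0 : (a * (b * (a * (b * (a * (b ^ 2 * (a * (b * (a * (b ^ 2)))))))))) ^ 2 = 1 := by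
    simpa only [pow_two, mul_assoc] using hW
  have r1 : (a * (b * (a * (b ^ 2 * (a * (b * (a * (b ^ 2 * (a * (b)))))))))) ^ 2 = 1 := by
    simpa only [mul_assoc] using rotate_sq_eq_one r0
  have r2 : (a * (b ^ 2 * (a * (b * (a * (b ^ 2 * (a * (b * (a * (b)))))))))) ^ 2 = 1 := by
    simpa only [mul_assoc] using rotate_sq_eq_one r1
  have r3 : (a * (b * (a * (b ^ 2 * (a * (b * (a * (b * (a * (b ^ 2)))))))))) ^ 2 = 1 := by
    simpa only [mul_assoc] using rotate_sq_eq_one r2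
  have r4 : (a * (b ^ 2 * (a * (b * (a * (b * (a * (b ^ 2 * (a * (b)))))))))) ^ 2 = 1 := by
    simpa only [mul_assoc] using rotate_sq_eq_one r3
  obtain ⟨s0, h0⟩ : ∃ g : G, g = 1 := ⟨_, rfl⟩
  obtain ⟨s1, h1⟩ : ∃ g, g = a * (b ^ 2 * s0) := ⟨_, rfl⟩
  obtain ⟨s2, h2⟩ : ∃ g, g = a * (b * s1) := ⟨_, rfl⟩
  obtain ⟨s3, h3⟩ : ∃ g, g = a * (b ^ 2 * s1) := ⟨_, rfl⟩
  obtain ⟨s4, h4⟩ : ∃ g, g = a * (b * s2) := ⟨_, rfl⟩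
  obtain ⟨s5, h5⟩ : ∃ g, g = a * (b ^ 2 * s2) := ⟨_, rfl⟩
  obtain ⟨s6, h6⟩ : ∃ g, g = a * (b * s3) := ⟨_, rfl⟩
  obtain ⟨s7, h7⟩ : ∃ g, g = a * (b ^ 2 * s3) := ⟨_, rfl⟩
  obtain ⟨s8, h8⟩ : ∃ g, g = a * (b * s4) := ⟨_, rfl⟩
  obtain ⟨s9, h9⟩ : ∃ g, g = a * (b ^ 2 * s4) := ⟨_, rfl⟩
  obtain ⟨s10, h10⟩ : ∃ g, g = a * (b ^ 2 * s7) := ⟨_, rfl⟩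
  obtain ⟨s11, h11⟩ : ∃ g, g = a * (b ^ 2 * s9) := ⟨_, rfl⟩
  refine ⟨![s0, s1, s2, s3, s4, s5, s6, s7, s8, s9, s10, s11], ?_⟩
  generalize hs : (![s0, s1, s2, s3, s4, s5, s6, s7, s8, s9, s10, s11] : Fin 12 → G) = s
  have e0 : Edge (rep b t s) a 0 1 0 0 1 := edge_of_rep_eq ha (by simp [rep, ← hs, ht, h0])
  have e1 : Edge (rep b t s) a 0 2 1 0 0 := edge_of_rep_eq ha (by simp [rep, ← hs, h1])
  have e2 : Edge (rep b t s) a 1 1 2 0 0 := edge_of_rep_eq ha (by simp [rep, ← hs, h2])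
  have e3 : Edge (rep b t s) a 1 2 3 0 0 := edge_of_rep_eq ha (by simp [rep, ← hs, h3])
  have e4 : Edge (rep b t s) a 2 1 4 0 0 := edge_of_rep_eq ha (by simp [rep, ← hs, h4])
  have e5 : Edge (rep b t s) a 2 2 5 0 0 := edge_of_rep_eq ha (by simp [rep, ← hs, h5])
  have e6 : Edge (rep b t s) a 3 1 6 0 0 := edge_of_rep_eq ha (by simp [rep, ← hs, h6])
  have e7 : Edge (rep b t s) a 3 2 7 0 0 := edge_of_rep_eq ha (by simp [rep, ← hs, h7])
  have e8 : Edge (rep b t s) a 4 1 8 0 0 := edge_of_rep_eq ha (by simp [rep, ← hs, h8])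
  have e9 : Edge (rep b t s) a 4 2 9 0 0 := edge_of_rep_eq ha (by simp [rep, ← hs, h9])
  have e10 : Edge (rep b t s) a 7 2 10 0 0 := edge_of_rep_eq ha (by simp [rep, ← hs, h10])
  have e11 : Edge (rep b t s) a 9 2 11 0 0 := edge_of_rep_eq ha (by simp [rep, ← hs, h11])
  have hbφ := mul_rep hb t s
  have ht1 {i e k l} := pow_eq_one_of_rep_eq (b := b) (t := t) (s := s) (i := i) (e := e) (k := k) (l := l)
  generalize rep b t s = φ at *
  have e12 : Edge φ a 6 2 5 1 3 := edge_of_forall ha fun k => by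
    rw [mul_eq_of_sq_eq_one ha r1]
    simp [pow_two, mul_assoc, hbφ, add_assoc, e0, e1, e2, e3, e5, e6]
  have e13 : Edge φ a 5 2 6 1 (-5) := edge_of_forall ha fun k => by
    rw [mul_eq_of_sq_eq_one ha r0]
    simp [pow_two, mul_assoc, hbφ, add_assoc, e0, e1, e3, e6, e12]
  have e14 : Edge φ a 7 1 9 1 2 := edge_of_forall ha fun k => by
    rw [mul_eq_of_sq_eq_one ha r3]
    simp [pow_two, mul_assoc, hbφ, add_assoc, e0, e1, e2, e3, e4, e7, e9]
  have e15 : Edge φ a 8 2 10 1 (-7) := edge_of_forall ha fun k => by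
    rw [mul_eq_of_sq_eq_one ha r1]
    simp [pow_two, mul_assoc, hbφ, add_assoc, e4, e5, e6, e7, e8, e10, e12, e13]
  have e16 : Edge φ a 8 1 10 2 (-9) := edge_of_forall ha fun k => by
    rw [mul_eq_of_sq_eq_one ha r4]
    simp [pow_two, mul_assoc, hbφ, add_assoc, e2, e3, e4, e7, e9, e10, e14, e15]
  have e17 : Edge φ a 11 2 11 1 9 := edge_of_forall ha fun k => by
    rw [mul_eq_of_sq_eq_one ha r1]
    simp [pow_two, mul_assoc, hbφ, add_assoc, e8, e9, e10, e11, e14, e15, e16]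
  refine ⟨?_, fun i e => ?_⟩
  · have h := mul_eq_of_sq_eq_one ha r4 (φ 1 1 0)
    simp [pow_two, mul_assoc, hbφ, e2, e3, e4, e7, e9, e11, e14, e17] at h
    exact ht1 h.symm 20 (by norm_num)
  · fin_cases i <;> fin_cases e <;> simp [Edge, table2, e0, e1, e2, e3, e4, e5, e6, e7, e8, e9, e10, e11, e12, e13, e14, e15, e16, e17]

end Enumeration

section Tables

theorem involutive_xMap_table1 : Function.Involutive (xMap 2 table1) := by
  unfold Function.Involutive; decide +kernel

theorem involutive_xMap_table2 : Function.Involutive (xMap 20 table2) := by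
  unfold Function.Involutive; decide +kernel

theorem involutive_xMap_table4 : Function.Involutive (xMap 8 table4) := by
  unfold Function.Involutive; decide +kernel

theorem lift_W1_sq :
    FreeGroup.lift ![involutive_xMap_table1.toPerm, yPerm 1 2] W1 ^ 2 = 1 := by
  simp only [W1, x, y, map_mul, FreeGroup.lift_apply_of]
  refine Equiv.ext ?_
  decide +kernel

theorem lift_W2_sq :
    FreeGroup.lift ![involutive_xMap_table2.toPerm, yPerm 12 20] W2 ^ 2 = 1 := by
  simp only [W2, x, y, map_mul, map_pow, FreeGroup.lift_apply_of]
  refine Equiv.ext ?_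
  decide +kernel

theorem lift_W4_sq :
    FreeGroup.lift ![involutive_xMap_table4.toPerm, yPerm 2 8] W4 ^ 2 = 1 := by
  simp only [W4, x, y, map_mul, map_pow, FreeGroup.lift_apply_of]
  refine Equiv.ext ?_
  decide +kernel

theorem finite_and_card_W1 : Finite (GT W1) ∧ Nat.card (GT W1) = 6 := by
  have hW := mk_word_sq (W := W1) (v := x * y) rfl
  simp only [map_mul] at hW
  obtain ⟨s, hs⟩ := exists_edges_table1 rfl (mk_x_sq W1) (mk_y_pow_three W1) hW
  exact finite_and_card table1 s hW hs rfl (by decide) involutive_xMap_table1 lift_W1_sq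

theorem finite_and_card_W2 : Finite (GT W2) ∧ Nat.card (GT W2) = 720 := by
  have hW := mk_word_sq (W := W2) (v := (x * y) ^ 2 * (x * y ^ 2) * (x * y) * (x * y ^ 2)) rfl
  simp only [map_mul, map_pow] at hW
  obtain ⟨s, ht, hs⟩ := exists_edges_table2 rfl (mk_x_sq W2) (mk_y_pow_three W2) hW
  exact finite_and_card table2 s ht hs rfl (by decide) involutive_xMap_table2 lift_W2_sq

theorem finite_and_card_W4 : Finite (GT W4) ∧ Nat.card (GT W4) = 48 := by
  have hW := mk_word_sq (W := W4) (v := (x * y) ^ 2 * (x * y ^ 2)) rfl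
  simp only [map_mul, map_pow] at hW
  obtain ⟨s, ht, hs⟩ := exists_edges_table4 rfl (mk_x_sq W4) (mk_y_pow_three W4) hW
  exact finite_and_card table4 s ht hs rfl (by decide) involutive_xMap_table4 lift_W4_sq

end Tables

end GTEnum

theorem stmt_16 :
    (Finite (GT W1) ∧ Nat.card (GT W1) = 6) ∧
    (Finite (GT W2) ∧ Nat.card (GT W2) = 720) ∧
    (Finite (GT W4) ∧ Nat.card (GT W4) = 48) := by
  exact ⟨GTEnum.finite_and_card_W1, GTEnum.finite_and_card_W2, GTEnum.finite_and_card_W4⟩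
end

section
/- Each of the four groups ⟨x,y | x² = y³ = ((xy)⁵(xy²)³(xy)²xy²xy(xy²)²)² = 1⟩, ⟨x,y | x² = y³ = ((xy)⁴(xy²)²xy(xy²)³(xy)²xy²xy(xy²)²)² = 1⟩, ⟨x,y | x² = y³ = ((xy)⁴(xy²)⁴xy(xy²)³(xy)²xy²xy(xy²)²)² = 1⟩ and ⟨x,y | x² = y³ = ((xy)⁴(xy²)⁴xy(xy²)²xy(xy²)³(xy)³(xy²)²xyxy²)² = 1⟩ is large: it has a subgroup of finite index admitting a surjective homomorphism onto the free group of rank 2. In particular each contains a subgroup isomorphic to the free group of rank 2. -/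
/-- The word `(xy)⁵(xy²)³(xy)²xy²xy(xy²)²`. -/
def W9a : F := (x*y)^5 * (x*y^2)^3 * (x*y)^2 * (x*y^2) * (x*y) * (x*y^2)^2

/-- The word `(xy)⁴(xy²)²xy(xy²)³(xy)²xy²xy(xy²)²`. -/
def W12a : F := (x*y)^4 * (x*y^2)^2 * (x*y) * (x*y^2)^3 * (x*y)^2 * (x*y^2) * (x*y) * (x*y^2)^2

/-- The word `(xy)⁴(xy²)⁴xy(xy²)³(xy)²xy²xy(xy²)²`. -/
def W13a : F := (x*y)^4 * (x*y^2)^4 * (x*y) * (x*y^2)^3 * (x*y)^2 * (x*y^2) * (x*y) * (x*y^2)^2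

/-- The word `(xy)⁴(xy²)⁴xy(xy²)²xy(xy²)³(xy)³(xy²)²xyxy²`. -/
def W15a : F := (x*y)^4 * (x*y^2)^4 * (x*y) * (x*y^2)^2 * (x*y) * (x*y^2)^3 *
  (x*y)^3 * (x*y^2)^2 * (x*y) * (x*y^2)

/-- A group is large if a finite-index subgroup surjects onto the free group of rank 2. -/
def IsLarge (G : Type) [Group G] : Prop :=
  ∃ H : Subgroup G, H.FiniteIndex ∧ ∃ f : H →* FreeGroup (Fin 2), Function.Surjective f

/-- Left multiplication of a word by a letter, cancelling an inverse pair. -/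
def pushLetter (a : Fin 2 × Bool) : List (Fin 2 × Bool) → List (Fin 2 × Bool)
  | [] => [a]
  | b :: l => if a.1 = b.1 ∧ a.2 = !b.2 then l else a :: b :: l

theorem mk_pushLetter (a : Fin 2 × Bool) (l : List (Fin 2 × Bool)) :
    FreeGroup.mk (pushLetter a l) = FreeGroup.mk [a] * FreeGroup.mk l := by
  cases l with
  | nil => simp [pushLetter]
  | cons b l =>
    rw [pushLetter]
    split_ifs with h
    · obtain ⟨i, s⟩ := a
      obtain ⟨j, t⟩ := b
      obtain ⟨rfl, rfl⟩ : i = j ∧ s = !t := h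
      rw [FreeGroup.mul_mk]
      exact (Quot.sound FreeGroup.Red.Step.cons_not_rev).symm
    · rw [FreeGroup.mul_mk]
      rfl

theorem mk_foldr_pushLetter (c l : List (Fin 2 × Bool)) :
    FreeGroup.mk (c.foldr pushLetter l) = FreeGroup.mk c * FreeGroup.mk l := by
  induction c with
  | nil => rfl
  | cons a c ih =>
    rw [List.foldr_cons, mk_pushLetter, ih, ← mul_assoc, FreeGroup.mul_mk]
    rfl

/-- A right action of `x` and `y` on `n` points, in which the edge traversed by `x` from each
point carries a label in the free group, and edges traversed by `y` carry the trivial label. -/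
structure LabelledAction (n : ℕ) where
  /-- The point reached from a given one by `x`. -/
  xStep : Fin n → Fin n
  /-- The point reached from a given one by `y`. -/
  yStep : Fin n → Fin n
  /-- The label of the edge by which `x` leaves a given point. -/
  label : Fin n → List (Fin 2 × Bool)

namespace LabelledAction

variable {n : ℕ} (A : LabelledAction n)

/-- The end point and the label of the path that a positive word in `x` (letter `0`) and
`y` (letter `1`) traces from a given point. -/
def walk : List (Fin 2) → Fin n → Fin n × List (Fin 2 × Bool)
  | [], i => (i, [])
  | 0 :: w, i => ((walk w (A.xStep i)).1, (A.label i).foldr pushLetter (walk w (A.xStep i)).2)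
  | 1 :: w, i => walk w (A.yStep i)

/-- Monomial `n × n` matrices over the free group of rank 2. -/
abbrev Monomial (n : ℕ) : Type := (Fin n → F) ⋊[mulAutArrow] Equiv.Perm (Fin n)

/-- The homomorphism to monomial matrices determined by a labelled action by permutations. -/
def toMonomial (πx πy : Equiv.Perm (Fin n)) : F →* Monomial n :=
  FreeGroup.lift ![⟨fun i => FreeGroup.mk (A.label i), πx⁻¹⟩, ⟨1, πy⁻¹⟩]

variable {A} {πx πy : Equiv.Perm (Fin n)}

theorem toMonomial_walk (hπx : ⇑πx = A.xStep) (hπy : ⇑πy = A.yStep) (w : List (Fin 2))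
    (i : Fin n) :
    (A.toMonomial πx πy (w.map FreeGroup.of).prod).right⁻¹ i = (A.walk w i).1 ∧
      (A.toMonomial πx πy (w.map FreeGroup.of).prod).left i = FreeGroup.mk (A.walk w i).2 := by
  induction w generalizing i with
  | nil => exact ⟨rfl, rfl⟩
  | cons s w ih =>
    have hx : A.toMonomial πx πy (.of 0) = ⟨fun i => FreeGroup.mk (A.label i), πx⁻¹⟩ := by
      simp [toMonomial]
    have hy : A.toMonomial πx πy (.of 1) = ⟨1, πy⁻¹⟩ := by simp [toMonomial]
    rw [List.map_cons, List.prod_cons, map_mul, SemidirectProduct.mul_right,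
      SemidirectProduct.mul_left, mul_inv_rev, Equiv.Perm.mul_apply, Pi.mul_apply]
    fin_cases s
    · simp only [Fin.zero_eta, hx, inv_inv, hπx, walk, mk_foldr_pushLetter]
      refine ⟨(ih _).1, congrArg _ ?_⟩
      rw [← (ih _).2, ← hπx, ← inv_inv πx]
      rfl
    · simp only [Fin.mk_one, hy, inv_inv, hπy, walk, Pi.one_apply, one_mul]
      refine ⟨(ih _).1, ?_⟩
      rw [← (ih _).2, ← hπy, ← inv_inv πy]
      rfl

theorem toMonomial_eq_one (hπx : ⇑πx = A.xStep) (hπy : ⇑πy = A.yStep) {w : List (Fin 2)}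
    (hw : ∀ i, A.walk w i = (i, [])) :
    A.toMonomial πx πy (w.map FreeGroup.of).prod = 1 := by
  have h := toMonomial_walk hπx hπy w
  simp only [hw] at h
  refine SemidirectProduct.ext (funext fun i => (h i).2) (inv_injective ?_)
  exact Equiv.ext fun i => (h i).1

/-- A labelled action of a generalised triangle group which admits loops at a point labelled by
the two free generators witnesses largeness. -/
theorem isLarge [NeZero n] (A : LabelledAction n) {W : F}
    (hx : ∀ i, A.walk [0, 0] i = (i, [])) (hy : ∀ i, A.walk [1, 1, 1] i = (i, []))
    {w : List (Fin 2)} (hw : W = (w.map FreeGroup.of).prod)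
    (hW : ∀ i, A.walk (w ++ w) i = (i, [])) (u : Fin 2 → List (Fin 2))
    (hu : ∀ k, A.walk (u k) 0 = (0, [(k, true)])) : IsLarge (GT W) := by
  have hxx : ∀ i, A.xStep (A.xStep i) = i := fun i => congrArg Prod.fst (hx i)
  have hyy : ∀ i, A.yStep (A.yStep (A.yStep i)) = i := fun i => congrArg Prod.fst (hy i)
  let πx : Equiv.Perm (Fin n) := ⟨A.xStep, A.xStep, hxx, hxx⟩
  let πy : Equiv.Perm (Fin n) := ⟨A.yStep, A.yStep ∘ A.yStep, hyy, hyy⟩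
  have hrels : ∀ r ∈ rels W, A.toMonomial πx πy r = 1 := by
    rintro r (rfl | rfl | rfl)
    · simpa [x, pow_succ] using toMonomial_eq_one (πx := πx) (πy := πy) rfl rfl hx
    · simpa [y, pow_succ, mul_assoc] using toMonomial_eq_one (πx := πx) (πy := πy) rfl rfl hy
    · simpa [hw, pow_two] using toMonomial_eq_one (πx := πx) (πy := πy) rfl rfl hW
  let φ : GT W →* Monomial n := QuotientGroup.lift (Subgroup.normalClosure (rels W))
    (A.toMonomial πx πy) (Subgroup.normalClosure_le_normal hrels)
  have hφ : ∀ g : F, φ (_root_.mk W g) = A.toMonomial πx πy g := fun _ => rfl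
  let H : Subgroup (GT W) :=
    (MulAction.stabilizer (Equiv.Perm (Fin n)) (0 : Fin n)).comap
      (SemidirectProduct.rightHom.comp φ)
  have hH : H.FiniteIndex :=
    ⟨(Subgroup.index_comap _ _).trans_ne (Subgroup.instFiniteIndex_subgroupOf _ _).index_ne_zero⟩
  let f : H →* F :=
    { toFun h := (φ h).left 0
      map_one' := by simp
      map_mul' := by
        intro g h
        have hg : (φ g).right⁻¹ 0 = 0 := Equiv.Perm.inv_eq_iff_eq.2 g.2.symm
        rw [Subgroup.coe_mul, map_mul, SemidirectProduct.mul_left, Pi.mul_apply]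
        exact congrArg _ (congrArg (φ h).left hg) }
  refine ⟨H, hH, f, MonoidHom.range_eq_top.1 ?_⟩
  rw [eq_top_iff, ← FreeGroup.closure_range_of, Subgroup.closure_le]
  rintro _ ⟨k, rfl⟩
  have h := toMonomial_walk (A := A) (πx := πx) (πy := πy) rfl rfl (u k) 0
  rw [hu, ← hφ] at h
  exact ⟨⟨_root_.mk W ((u k).map FreeGroup.of).prod, (Equiv.Perm.inv_eq_iff_eq.1 h.1).symm⟩, h.2⟩

end LabelledAction

/-- A large group contains a free subgroup of rank 2. -/
theorem IsLarge.exists_freeSubgroup {G : Type} [Group G] (hG : IsLarge G) :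
    ∃ H : Subgroup G, Nonempty (H ≃* FreeGroup (Fin 2)) := by
  obtain ⟨H, -, f, hf⟩ := hG
  choose s hs using fun k => hf (.of k)
  have hfs : f.comp (FreeGroup.lift s) = MonoidHom.id _ := FreeGroup.ext_hom _ _ (by simp [hs])
  have hinj : Function.Injective (H.subtype.comp (FreeGroup.lift s)) :=
    H.subtype_injective.comp
      (Function.LeftInverse.injective (g := f) fun g => DFunLike.congr_fun hfs g)
  exact ⟨_, ⟨(MonoidHom.ofInjective hinj).symm⟩⟩

/-- A labelled action on forty points, compatible with the relators of `W9a`, `W12a` and `W13a`. -/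
def action40 : LabelledAction 40 where
  xStep i :=
    ([1, 0, 4, 7, 2, 10, 13, 3, 16, 19, 5, 22, 25, 6, 28, 17, 8, 15, 31, 9, 34, 24, 11, 37, 21,
    12, 36, 29, 14, 27, 38, 18, 39, 35, 20, 33, 26, 23, 30, 32].getD i 0)
  yStep i :=
    ([0, 2, 3, 1, 5, 6, 4, 8, 9, 7, 11, 12, 10, 14, 15, 13, 17, 18, 16, 20, 21, 19, 23, 24, 22,
    26, 27, 25, 29, 30, 28, 32, 33, 31, 35, 36, 34, 37, 38, 39].getD i 0)
  label i := match i.val with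
    | 15 | 35 => [(0, false)]
    | 17 | 33 => [(0, true)]
    | 26 | 27 => [(1, true)]
    | 29 | 36 => [(1, false)]
    | _ => []

/-- Words tracing loops at the base point with labels the two free generators. -/
def loops40 : Fin 2 → List (Fin 2)
  | 0 => [0, 1, 1, 0, 1, 0, 1, 0, 1, 0, 1, 0, 1, 1, 0]
  | 1 => [0, 1, 0, 1, 0, 1, 1, 0, 1, 0, 1, 0, 1, 1, 0, 1, 0, 1, 0]

/-- A labelled action on sixty points, compatible with the relators of `W15a`. -/
def action60 : LabelledAction 60 where
  xStep i :=
    ([3, 6, 9, 0, 12, 15, 1, 18, 21, 2, 24, 27, 4, 29, 30, 5, 33, 19, 7, 17, 36, 8, 39, 25, 10,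
    23, 42, 11, 45, 13, 14, 48, 34, 16, 32, 51, 20, 53, 40, 22, 38, 54, 26, 56, 46, 28, 44,
    49, 31, 47, 57, 35, 59, 37, 41, 58, 43, 50, 55, 52].getD i 0)
  yStep i :=
    ([1, 2, 0, 4, 5, 3, 7, 8, 6, 10, 11, 9, 13, 14, 12, 16, 17, 15, 19, 20, 18, 22, 23, 21, 25,
    26, 24, 28, 29, 27, 31, 32, 30, 34, 35, 33, 37, 38, 36, 40, 41, 39, 43, 44, 42, 46, 47,
    45, 49, 50, 48, 52, 53, 51, 55, 56, 54, 58, 59, 57].getD i 0)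
  label i := match i.val with
    | 23 => [(0, false)]
    | 25 => [(0, true)]
    | 32 => [(0, false), (1, false), (0, true)]
    | 34 => [(0, false), (1, true), (0, true)]
    | 37 | 43 | 44 | 59 => [(1, false), (0, true)]
    | 46 | 52 | 53 | 56 => [(0, false), (1, true)]
    | _ => []

/-- Words tracing loops at the base point with labels the two free generators. -/
def loops60 : Fin 2 → List (Fin 2)
  | 0 => [1, 1, 0, 1, 0, 1, 0, 1, 0, 1, 0, 1, 1]
  | 1 => [1, 1, 0, 1, 0, 1, 0, 1, 1, 0, 1, 1, 0, 1, 1, 0, 1, 1, 0, 1, 0, 1, 1, 0, 1]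

theorem isLarge_W9a : IsLarge (GT W9a) :=
  action40.isLarge (by decide +kernel) (by decide +kernel)
    (w :=
    [0, 1, 0, 1, 0, 1, 0, 1, 0, 1, 0, 1, 1, 0, 1, 1, 0, 1, 1, 0, 1, 0, 1, 0, 1, 1, 0, 1, 0,
    1, 1, 0, 1, 1])
    (by simp [W9a, x, y, pow_succ, mul_assoc]) (by decide +kernel) loops40 (by decide +kernel)

theorem isLarge_W12a : IsLarge (GT W12a) :=
  action40.isLarge (by decide +kernel) (by decide +kernel)
    (w :=
    [0, 1, 0, 1, 0, 1, 0, 1, 0, 1, 1, 0, 1, 1, 0, 1, 0, 1, 1, 0, 1, 1, 0, 1, 1, 0, 1, 0, 1,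
    0, 1, 1, 0, 1, 0, 1, 1, 0, 1, 1])
    (by simp [W12a, x, y, pow_succ, mul_assoc]) (by decide +kernel) loops40 (by decide +kernel)

theorem isLarge_W13a : IsLarge (GT W13a) :=
  action40.isLarge (by decide +kernel) (by decide +kernel)
    (w :=
    [0, 1, 0, 1, 0, 1, 0, 1, 0, 1, 1, 0, 1, 1, 0, 1, 1, 0, 1, 1, 0, 1, 0, 1, 1, 0, 1, 1, 0,
    1, 1, 0, 1, 0, 1, 0, 1, 1, 0, 1, 0, 1, 1, 0, 1, 1])
    (by simp [W13a, x, y, pow_succ, mul_assoc]) (by decide +kernel) loops40 (by decide +kernel)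

theorem isLarge_W15a : IsLarge (GT W15a) :=
  action60.isLarge (by decide +kernel) (by decide +kernel)
    (w :=
    [0, 1, 0, 1, 0, 1, 0, 1, 0, 1, 1, 0, 1, 1, 0, 1, 1, 0, 1, 1, 0, 1, 0, 1, 1, 0, 1, 1, 0,
    1, 0, 1, 1, 0, 1, 1, 0, 1, 1, 0, 1, 0, 1, 0, 1, 0, 1, 1, 0, 1, 1, 0, 1, 0, 1, 1])
    (by simp [W15a, x, y, pow_succ, mul_assoc]) (by decide +kernel) loops60 (by decide +kernel)

theorem stmt_17 :
    (IsLarge (GT W9a) ∧ IsLarge (GT W12a) ∧ IsLarge (GT W13a) ∧ IsLarge (GT W15a)) ∧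
    ((∃ H : Subgroup (GT W9a), Nonempty (H ≃* FreeGroup (Fin 2))) ∧
     (∃ H : Subgroup (GT W12a), Nonempty (H ≃* FreeGroup (Fin 2))) ∧
     (∃ H : Subgroup (GT W13a), Nonempty (H ≃* FreeGroup (Fin 2))) ∧
     (∃ H : Subgroup (GT W15a), Nonempty (H ≃* FreeGroup (Fin 2)))) :=
  ⟨⟨isLarge_W9a, isLarge_W12a, isLarge_W13a, isLarge_W15a⟩,
    isLarge_W9a.exists_freeSubgroup, isLarge_W12a.exists_freeSubgroup,
    isLarge_W13a.exists_freeSubgroup, isLarge_W15a.exists_freeSubgroup⟩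
end

section
/- The group G₉ = ⟨x,y | x² = y³ = ((xy)⁴xy²xy(xy²)³xy(xy²)²xyxy²(xy)²(xy²)³)² = 1⟩ contains a subgroup isomorphic to the free group of rank 2. -/
/-- The word `(xy)⁴xy²xy(xy²)³xy(xy²)²xyxy²(xy)²(xy²)³` defining `G₉`. -/
def W9 : F := (x*y)^4 * (x*y^2) * (x*y) * (x*y^2)^3 * (x*y) * (x*y^2)^2 *
  (x*y) * (x*y^2) * (x*y)^2 * (x*y^2)^3

namespace SmallCancellation

/-- Letters of words in `x`, `y`, `y⁻¹`, taken modulo `x = x⁻¹`: `none` stands for `x`,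
`some true` for `y` and `some false` for `y⁻¹`. -/
abbrev Letter : Type := Option Bool

/-- The inverse of a letter. -/
def Letter.inv (l : Letter) : Letter := l.map not

@[simp] theorem Letter.inv_inv (l : Letter) : l.inv.inv = l := by
  rcases l with _ | _ | _ <;> rfl

/-- The formal inverse of a word. -/
def invRev (w : List Letter) : List Letter := (w.map Letter.inv).reverse

theorem invRev_append (a b : List Letter) : invRev (a ++ b) = invRev b ++ invRev a := by
  simp [invRev]

/-- Words that become empty after deleting adjacent inverse letters and subwords in `P`. -/
inductive Fillable (P : List Letter → Prop) : List Letter → Prop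
  | nil : Fillable P []
  | cancel (a b : List Letter) (l : Letter) : Fillable P (a ++ b) →
      Fillable P (a ++ l :: l.inv :: b)
  | rel (a b r : List Letter) : P r → Fillable P (a ++ b) → Fillable P (a ++ r ++ b)

namespace Fillable

variable {P : List Letter → Prop}

theorem insert {v : List Letter} (hv : Fillable P v) :
    ∀ {a b : List Letter}, Fillable P (a ++ b) → Fillable P (a ++ v ++ b) := by
  induction hv with
  | nil => simp
  | cancel a' b' l _ ih =>
    intro a b h
    have := cancel (a ++ a') (b' ++ b) l (by simpa using ih h)
    simpa using this
  | rel a' b' r hr _ ih =>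
    intro a b h
    have := rel (a ++ a') (b' ++ b) r hr (by simpa using ih h)
    simpa using this

theorem append {v w : List Letter} (hv : Fillable P v) (hw : Fillable P w) :
    Fillable P (v ++ w) := by
  simpa using hv.insert (a := []) (b := w) hw

theorem of_rel {r : List Letter} (hr : P r) : Fillable P r := by
  simpa using rel [] [] r hr nil

theorem append_invRev (a : List Letter) : Fillable P (a ++ invRev a) := by
  induction a using List.reverseRecOn with
  | nil => exact nil
  | append_singleton a l ih =>
    have := cancel a (invRev a) l ih
    simpa [invRev] using this

theorem invRev_append (a : List Letter) : Fillable P (invRev a ++ a) := by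
  induction a with
  | nil => exact nil
  | cons l a ih =>
    have := cancel (invRev a) a l.inv ih
    simpa [invRev] using this

end Fillable

/-- The vertex potential `f` integrates the cochain `c` along the path `A`, starting with the
value `g`. -/
def IntegratesFrom {D : Type*} (f c : D → ℚ) : ℚ → List D → Prop
  | _, [] => True
  | g, d :: A => f d = g ∧ IntegratesFrom f c (g + c d) A

section IntegratesFrom

variable {D : Type*} {f c c' : D → ℚ}

@[simp] theorem integratesFrom_nil (g : ℚ) : IntegratesFrom f c g [] := trivial

@[simp] theorem integratesFrom_cons (g : ℚ) (d : D) (A : List D) :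
    IntegratesFrom f c g (d :: A) ↔ f d = g ∧ IntegratesFrom f c (g + c d) A := Iff.rfl

@[simp] theorem integratesFrom_append (g : ℚ) (A B : List D) :
    IntegratesFrom f c g (A ++ B) ↔
      IntegratesFrom f c g A ∧ IntegratesFrom f c (g + (A.map c).sum) B := by
  induction A generalizing g with
  | nil => simp
  | cons d A ih => simp [ih, and_assoc, add_assoc]

theorem IntegratesFrom.congr {g : ℚ} {A : List D} (hA : ∀ d ∈ A, c d = c' d)
    (h : IntegratesFrom f c g A) : IntegratesFrom f c' g A := by
  induction A generalizing g with
  | nil => trivial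
  | cons d A ih =>
    have hd := hA d (by simp)
    exact ⟨h.1, hd ▸ ih (fun z hz => hA z (by simp [hz])) h.2⟩

theorem IntegratesFrom.cast {g g' : ℚ} {A : List D} (h : IntegratesFrom f c g A)
    (hg : g = g') : IntegratesFrom f c g' A := hg ▸ h

end IntegratesFrom

/-- A finite disjoint union of spherical maps: `faces` lists the darts along each face, `α` is
the edge involution, and `ℓ` labels the darts. Sphericity is the vanishing of the first
cohomology: each closed 1-cochain is the coboundary of a vertex potential. -/
structure IsSpherical {D : Type*} (ℓ : D → Letter) (α : D → D) (faces : List (List D)) :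
    Prop where
  nodup : faces.flatten.Nodup
  map_mem : ∀ d ∈ faces.flatten, α d ∈ faces.flatten
  invol : ∀ d ∈ faces.flatten, α (α d) = d
  map_ne : ∀ d ∈ faces.flatten, α d ≠ d
  label : ∀ d ∈ faces.flatten, ℓ (α d) = (ℓ d).inv
  exact : ∀ c : D → ℚ, (∀ d ∈ faces.flatten, c (α d) = - c d) →
    (∀ A ∈ faces, (A.map c).sum = 0) →
    ∃ f : D → ℚ, (∀ d ∈ faces.flatten, f (α d) = f d + c d) ∧
      ∀ A ∈ faces, ∃ g, IntegratesFrom f c g A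

namespace IsSpherical

variable {D : Type*} {ℓ : D → Letter} {α : D → D} {fs : List (List D)}

theorem perm {fs' : List (List D)} (h : IsSpherical ℓ α fs) (hp : fs.Perm fs') :
    IsSpherical ℓ α fs' := by
  have hf : ∀ d, d ∈ fs'.flatten ↔ d ∈ fs.flatten := fun d => (hp.flatten.mem_iff).symm
  refine ⟨hp.flatten.nodup_iff.1 h.nodup, ?_, ?_, ?_, ?_, ?_⟩
  · simpa only [hf] using h.map_mem
  · simpa only [hf] using h.invol
  · simpa only [hf] using h.map_ne
  · simpa only [hf] using h.label
  · simpa only [hf, hp.symm.mem_iff] using h.exact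

theorem drop_nil (h : IsSpherical ℓ α ([] :: fs)) : IsSpherical ℓ α fs := by
  refine ⟨by simpa using h.nodup, by simpa using h.map_mem, by simpa using h.invol,
    by simpa using h.map_ne, by simpa using h.label, ?_⟩
  intro c h1 h2
  obtain ⟨f, hf, hA⟩ := h.exact c (by simpa using h1) (by simpa using h2)
  exact ⟨f, by simpa using hf, fun A hA' => hA A (by simp [hA'])⟩

/-- Pinching a closed subpath off a face. -/
theorem pinch {A R B : List D} (h : IsSpherical ℓ α ((A ++ R ++ B) :: fs)) :
    IsSpherical ℓ α ((A ++ B) :: R :: fs) := by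
  have hp : ((A ++ B) :: R :: fs).flatten.Perm ((A ++ R ++ B) :: fs).flatten := by
    simp only [List.flatten_cons, List.append_assoc]
    refine List.Perm.append_left _ ?_
    rw [← List.append_assoc, ← List.append_assoc]
    exact List.perm_append_comm.append_right _
  refine ⟨hp.nodup_iff.2 h.nodup, ?_, ?_, ?_, ?_, ?_⟩
  · simpa only [hp.mem_iff] using h.map_mem
  · simpa only [hp.mem_iff] using h.invol
  · simpa only [hp.mem_iff] using h.map_ne
  · simpa only [hp.mem_iff] using h.label
  · intro c h1 h2
    have hAB : (A.map c).sum + (B.map c).sum = 0 := by simpa using h2 (A ++ B) (by simp)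
    have hR : (R.map c).sum = 0 := h2 R (by simp)
    obtain ⟨f, hf, hA⟩ := h.exact c (by simpa only [hp.mem_iff] using h1) (by
      intro C hC
      rcases List.mem_cons.1 hC with rfl | hC
      · simp only [List.map_append, List.sum_append]; linarith
      · exact h2 C (by simp [hC]))
    refine ⟨f, by simpa only [hp.mem_iff] using hf, ?_⟩
    obtain ⟨g, hg⟩ := hA _ (List.mem_cons_self ..)
    simp only [integratesFrom_append, List.map_append, List.sum_append, hR, add_zero] at hg
    intro C hC
    simp only [List.mem_cons] at hC
    rcases hC with hC | hC | hC
    · exact ⟨g, by simpa [hC] using ⟨hg.1.1, hg.2⟩⟩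
    · exact ⟨_, hC ▸ hg.1.2⟩
    · exact hA C (by simp [hC])

/-- Folding together two consecutive darts with inverse labels. -/
theorem fold {A B : List D} {d d' : D} (h : IsSpherical ℓ α ((A ++ d :: d' :: B) :: fs))
    (hl : ℓ d' = (ℓ d).inv) : ∃ α', IsSpherical ℓ α' ((A ++ B) :: fs) := by
  classical
  have hp : ((A ++ d :: d' :: B) :: fs).flatten.Perm (d :: d' :: ((A ++ B) :: fs).flatten) := by
    simp only [List.flatten_cons, List.append_assoc, List.cons_append]
    exact List.perm_middle.trans (List.perm_middle.cons _)
  have hnd := hp.nodup_iff.1 h.nodup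
  have hmem : ∀ z, z ∈ ((A ++ d :: d' :: B) :: fs).flatten ↔
      z = d ∨ z = d' ∨ z ∈ ((A ++ B) :: fs).flatten := fun z => by
    rw [hp.mem_iff, List.mem_cons, List.mem_cons]
  have h_mem := h.map_mem
  have h_inv := h.invol
  have h_ne := h.map_ne
  have h_lab := h.label
  have h_ex := h.exact
  simp only [hmem] at h_mem h_inv h_ne h_lab h_ex
  simp only [List.nodup_cons, List.mem_cons, not_or] at hnd
  obtain ⟨⟨hdd, hd⟩, hd', hnd⟩ := hnd
  generalize hL : ((A ++ B) :: fs).flatten = L at *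
  have hA : ∀ z ∈ A, z ∈ L := fun z hz => by simp [← hL, hz]
  have hB : ∀ z ∈ B, z ∈ L := fun z hz => by simp [← hL, hz]
  have hC : ∀ C ∈ fs, ∀ z ∈ C, z ∈ L := fun C hC z hz => by
    rw [← hL]; exact List.mem_flatten.2 ⟨C, by simp [hC], hz⟩
  by_cases hcase : α d = d'
  · refine ⟨α, hL ▸ hnd, ?_, ?_, ?_, ?_, ?_⟩ <;> simp only [hL]
    · intro z hz
      rcases h_mem z (by simp [hz]) with h1 | h1 | h1
      · grind
      · grind
      · exact h1
    · exact fun z hz => h_inv z (by simp [hz])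
    · exact fun z hz => h_ne z (by simp [hz])
    · exact fun z hz => h_lab z (by simp [hz])
    · intro c h1 h2
      set c' : D → ℚ := fun z => if z ∈ L then c z else 0 with hc'
      have hc : ∀ z ∈ L, c' z = c z := fun z hz => by simp [hc', hz]
      have hcd : c' d = 0 := by simp [hc', hd]
      have hcd' : c' d' = 0 := by simp [hc', hd']
      have hAc : A.map c' = A.map c := List.map_congr_left fun z hz => hc z (hA z hz)
      have hBc : B.map c' = B.map c := List.map_congr_left fun z hz => hc z (hB z hz)
      obtain ⟨f, hf, hF⟩ := h_ex c' (by
        rintro z (rfl | rfl | hz)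
        · rw [hcase, hcd, hcd']; simp
        · rw [← hcase, h_inv d (by simp), hcase, hcd, hcd']; simp
        · have : α z ∈ L := by
            rcases h_mem z (by simp [hz]) with h1 | h1 | h1
            · grind
            · grind
            · exact h1
          rw [hc _ hz, hc _ this, h1 z hz]) (by
        intro C hCm
        rcases List.mem_cons.1 hCm with rfl | hCm
        · have := h2 (A ++ B) (by simp)
          simpa [hAc, hBc, hcd, hcd'] using this
        · rw [List.map_congr_left fun z hz => hc z (hC C hCm z hz)]
          exact h2 C (by simp [hCm]))
      refine ⟨f, fun z hz => by rw [hf z (by simp [hz]), hc z hz], ?_⟩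
      intro C hCm
      rcases List.mem_cons.1 hCm with rfl | hCm
      · obtain ⟨g, hg⟩ := hF _ (List.mem_cons_self ..)
        simp only [integratesFrom_append, integratesFrom_cons, hcd, hcd', add_zero] at hg
        exact ⟨g, (IntegratesFrom.congr (c := c') (fun z hz => hc z (by
          rcases List.mem_append.1 hz with hz | hz
          exacts [hA z hz, hB z hz])) (by simpa using ⟨hg.1, hg.2.2.2⟩))⟩
      · obtain ⟨g, hg⟩ := hF C (by simp [hCm])
        exact ⟨g, hg.congr fun z hz => hc z (hC C hCm z hz)⟩
  · have e1 : α d ∈ L := by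
      rcases h_mem d (by simp) with h1 | h1 | h1
      · exact absurd h1 (h_ne d (by simp))
      · exact absurd h1 hcase
      · exact h1
    have e2 : α d' ∈ L := by
      rcases h_mem d' (by simp) with h1 | h1 | h1
      · exact absurd (by rw [← h1, h_inv d' (by simp)]) hcase
      · exact absurd h1 (h_ne d' (by simp))
      · exact h1
    have i1 := h_inv d (by simp)
    have i2 := h_inv d' (by simp)
    have l1 := h_lab d (by simp)
    have l2 := h_lab d' (by simp)
    have hne : α d ≠ α d' := fun h => hdd (by rw [← i1, h, i2])
    set α' : D → D := fun z => if z = α d then α d' else if z = α d' then α d else α z with hα'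
    have a1 : α' (α d) = α d' := by simp [hα']
    have a2 : α' (α d') = α d := by simp [hα', hne.symm]
    have a3 : ∀ z, z ≠ α d → z ≠ α d' → α' z = α z := fun z h1 h2 => by simp [hα', h1, h2]
    have a4 : ∀ z ∈ L, z ≠ α d → z ≠ α d' → α z ∈ L ∧ α z ≠ α d ∧ α z ≠ α d' := by
      intro z hz h1 h2
      have := h_inv z (by simp [hz])
      rcases h_mem z (by simp [hz]) with h3 | h3 | h3
      · exact absurd (by rw [← h3, this]) h1
      · exact absurd (by rw [← h3, this]) h2
      · exact ⟨h3, fun h4 => hd (by rw [← i1, ← h4, this]; exact hz),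
          fun h4 => hd' (by rw [← i2, ← h4, this]; exact hz)⟩
    refine ⟨α', hL ▸ hnd, ?_, ?_, ?_, ?_, ?_⟩ <;> simp only [hL]
    · intro z hz
      by_cases z1 : z = α d
      · rw [z1, a1]; exact e2
      by_cases z2 : z = α d'
      · rw [z2, a2]; exact e1
      rw [a3 z z1 z2]; exact (a4 z hz z1 z2).1
    · intro z hz
      by_cases z1 : z = α d
      · rw [z1, a1, a2]
      by_cases z2 : z = α d'
      · rw [z2, a2, a1]
      rw [a3 z z1 z2, a3 _ (a4 z hz z1 z2).2.1 (a4 z hz z1 z2).2.2]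
      exact h_inv z (by simp [hz])
    · intro z hz
      by_cases z1 : z = α d
      · rw [z1, a1]; exact hne.symm
      by_cases z2 : z = α d'
      · rw [z2, a2]; exact hne
      rw [a3 z z1 z2]; exact h_ne z (by simp [hz])
    · intro z hz
      by_cases z1 : z = α d
      · rw [z1, a1, l1, l2, hl]
      by_cases z2 : z = α d'
      · rw [z2, a2, l1, l2, hl]; simp
      rw [a3 z z1 z2]; exact h_lab z (by simp [hz])
    · intro c h1 h2
      have hce : c (α d') = - c (α d) := by rw [← a1]; exact h1 _ e1
      set c' : D → ℚ := fun z => if z ∈ L then c z else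
        if z = d then - c (α d) else c (α d) with hc'
      have hc : ∀ z ∈ L, c' z = c z := fun z hz => by simp [hc', hz]
      have hcd : c' d = - c (α d) := by simp [hc', hd]
      have hcd' : c' d' = c (α d) := by simp [hc', hd', Ne.symm hdd]
      have hAc : A.map c' = A.map c := List.map_congr_left fun z hz => hc z (hA z hz)
      have hBc : B.map c' = B.map c := List.map_congr_left fun z hz => hc z (hB z hz)
      obtain ⟨f, hf, hF⟩ := h_ex c' (by
        rintro z (rfl | rfl | hz)
        · rw [hcd, hc _ e1]; simp
        · rw [hcd', hc _ e2, hce]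
        · by_cases z1 : z = α d
          · rw [z1, i1, hcd, hc _ e1]
          by_cases z2 : z = α d'
          · rw [z2, i2, hcd', hc _ e2, hce]; simp
          rw [hc _ hz, hc _ (a4 z hz z1 z2).1, ← h1 z hz, a3 z z1 z2]) (by
        intro C hCm
        rcases List.mem_cons.1 hCm with rfl | hCm
        · have := h2 (A ++ B) (by simp)
          simpa [hAc, hBc, hcd, hcd'] using this
        · rw [List.map_congr_left fun z hz => hc z (hC C hCm z hz)]
          exact h2 C (by simp [hCm]))
      obtain ⟨g, hg⟩ := hF _ (List.mem_cons_self ..)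
      simp only [integratesFrom_append, integratesFrom_cons, hcd, hcd'] at hg
      have f1 := hf d (by simp)
      have f2 := hf d' (by simp)
      rw [hcd] at f1
      rw [hcd'] at f2
      refine ⟨f, fun z hz => ?_, ?_⟩
      · by_cases z1 : z = α d
        · rw [z1, a1]; linarith
        by_cases z2 : z = α d'
        · rw [z2, a2]; linarith
        rw [a3 z z1 z2, hf z (by simp [hz]), hc z hz]
      · intro C hCm
        rcases List.mem_cons.1 hCm with rfl | hCm
        · exact ⟨g, (IntegratesFrom.congr (c := c') (fun z hz => hc z (by
            rcases List.mem_append.1 hz with hz | hz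
            exacts [hA z hz, hB z hz])) (by
              rw [integratesFrom_append]
              exact ⟨hg.1, hg.2.2.2.cast (by ring)⟩))⟩
        · obtain ⟨g, hg⟩ := hF C (by simp [hCm])
          exact ⟨g, hg.congr fun z hz => hc z (hC C hCm z hz)⟩

/-- Merging two faces along an edge. -/
theorem merge {A₁ B₁ A₂ B₂ : List D} {d e : D}
    (h : IsSpherical ℓ α ((A₁ ++ d :: B₁) :: (A₂ ++ e :: B₂) :: fs)) (hde : α d = e) :
    IsSpherical ℓ α ((A₁ ++ (B₂ ++ A₂) ++ B₁) :: fs) := by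
  classical
  have hp : ((A₁ ++ d :: B₁) :: (A₂ ++ e :: B₂) :: fs).flatten.Perm
      (d :: e :: ((A₁ ++ (B₂ ++ A₂) ++ B₁) :: fs).flatten) := by
    rw [← Multiset.coe_eq_coe]
    simp only [List.flatten_cons, ← Multiset.coe_add, ← Multiset.cons_coe,
      ← Multiset.singleton_add]
    abel
  have hnd := hp.nodup_iff.1 h.nodup
  have hmem : ∀ z, z ∈ ((A₁ ++ d :: B₁) :: (A₂ ++ e :: B₂) :: fs).flatten ↔
      z = d ∨ z = e ∨ z ∈ ((A₁ ++ (B₂ ++ A₂) ++ B₁) :: fs).flatten := fun z => by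
    rw [hp.mem_iff, List.mem_cons, List.mem_cons]
  have h_mem := h.map_mem
  have h_inv := h.invol
  have h_ne := h.map_ne
  have h_lab := h.label
  have h_ex := h.exact
  simp only [hmem] at h_mem h_inv h_ne h_lab h_ex
  simp only [List.nodup_cons, List.mem_cons, not_or] at hnd
  obtain ⟨⟨hdd, hd⟩, he, hnd⟩ := hnd
  generalize hL : ((A₁ ++ (B₂ ++ A₂) ++ B₁) :: fs).flatten = L at *
  have hA₁ : ∀ z ∈ A₁, z ∈ L := fun z hz => by simp [← hL, hz]
  have hB₁ : ∀ z ∈ B₁, z ∈ L := fun z hz => by simp [← hL, hz]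
  have hA₂ : ∀ z ∈ A₂, z ∈ L := fun z hz => by simp [← hL, hz]
  have hB₂ : ∀ z ∈ B₂, z ∈ L := fun z hz => by simp [← hL, hz]
  have hC : ∀ C ∈ fs, ∀ z ∈ C, z ∈ L := fun C hC z hz => by
    rw [← hL]; exact List.mem_flatten.2 ⟨C, by simp [hC], hz⟩
  have hed : α e = d := by rw [← hde, h_inv d (by simp)]
  have hαL : ∀ z ∈ L, α z ∈ L := by
    intro z hz
    have := h_inv z (by simp [hz])
    rcases h_mem z (by simp [hz]) with h1 | h1 | h1
    · exact absurd hz (by rw [← this, h1, hde]; exact he)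
    · exact absurd hz (by rw [← this, h1, hed]; exact hd)
    · exact h1
  refine ⟨hL ▸ hnd, ?_, ?_, ?_, ?_, ?_⟩ <;> simp only [hL]
  · exact hαL
  · exact fun z hz => h_inv z (by simp [hz])
  · exact fun z hz => h_ne z (by simp [hz])
  · exact fun z hz => h_lab z (by simp [hz])
  · intro c h1 h2
    set t : ℚ := (B₂.map c).sum + (A₂.map c).sum with ht
    set c' : D → ℚ := fun z => if z ∈ L then c z else if z = d then t else - t with hc'
    have hc : ∀ z ∈ L, c' z = c z := fun z hz => by simp [hc', hz]
    have hcd : c' d = t := by simp [hc', hd]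
    have hce : c' e = - t := by simp [hc', he, Ne.symm hdd]
    have hA₁c : A₁.map c' = A₁.map c := List.map_congr_left fun z hz => hc z (hA₁ z hz)
    have hB₁c : B₁.map c' = B₁.map c := List.map_congr_left fun z hz => hc z (hB₁ z hz)
    have hA₂c : A₂.map c' = A₂.map c := List.map_congr_left fun z hz => hc z (hA₂ z hz)
    have hB₂c : B₂.map c' = B₂.map c := List.map_congr_left fun z hz => hc z (hB₂ z hz)
    have hsum : (A₁.map c).sum + t + (B₁.map c).sum = 0 := by
      have := h2 _ (List.mem_cons_self ..)
      simp only [List.map_append, List.sum_append] at this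
      linarith
    obtain ⟨f, hf, hF⟩ := h_ex c' (by
      rintro z (rfl | rfl | hz)
      · rw [hde, hcd, hce]
      · rw [hed, hcd, hce]; simp
      · rw [hc _ hz, hc _ (hαL z hz), h1 z hz]) (by
      intro C hCm
      rcases List.mem_cons.1 hCm with rfl | hCm
      · simp only [List.map_append, List.map_cons, List.sum_append, List.sum_cons, hA₁c, hB₁c, hcd]
        linarith
      rcases List.mem_cons.1 hCm with rfl | hCm
      · simp only [List.map_append, List.map_cons, List.sum_append, List.sum_cons, hA₂c, hB₂c, hce]
        linarith
      · rw [List.map_congr_left fun z hz => hc z (hC C hCm z hz)]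
        exact h2 C (by simp [hCm]))
    refine ⟨f, fun z hz => by rw [hf z (by simp [hz]), hc z hz], ?_⟩
    intro C hCm
    rcases List.mem_cons.1 hCm with rfl | hCm
    · obtain ⟨g, hg⟩ := hF _ (List.mem_cons_self ..)
      obtain ⟨g₂, hg₂⟩ := hF (A₂ ++ e :: B₂) (by simp)
      have hfd := hf d (by simp)
      simp only [integratesFrom_append, integratesFrom_cons, hcd, hce, hA₁c, hA₂c] at hg hg₂
      rw [hde, hcd] at hfd
      refine ⟨g, IntegratesFrom.congr (c := c') (fun z hz => hc z (by
        simp only [List.mem_append] at hz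
        rcases hz with (hz | hz | hz) | hz
        exacts [hA₁ z hz, hB₂ z hz, hA₂ z hz, hB₁ z hz])) ?_⟩
      simp only [integratesFrom_append, List.map_append, List.sum_append, hA₁c, hA₂c, hB₂c]
      exact ⟨⟨hg.1, hg₂.2.2.cast (by linarith), hg₂.1.cast (by linarith)⟩,
        hg.2.2.cast (by linarith)⟩
    · obtain ⟨g, hg⟩ := hF C (by simp [hCm])
      exact ⟨g, hg.congr fun z hz => hc z (hC C hCm z hz)⟩

end IsSpherical

/-- The sphere with two faces whose common boundary reads the word `v`. -/
theorem exists_isSpherical (v : List Letter) :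
    ∃ (ℓ : ℕ × Bool → Letter) (α : ℕ × Bool → ℕ × Bool) (I O : List (ℕ × Bool)),
      IsSpherical ℓ α [O, I] ∧ I.map ℓ = v ∧ O.map ℓ = invRev v := by
  set n := v.length with hn
  set lab : ℕ → Letter := fun i => v.getD i none with hlab
  have hv : (List.range n).map lab = v := by
    apply List.ext_getElem
    · simp [hn]
    · intro i h1 h2
      simp [hlab, h2]
  set I : List (ℕ × Bool) := (List.range n).map fun i => (i, true) with hI
  set O : List (ℕ × Bool) := ((List.range n).map fun i => (i, false)).reverse with hO
  set ℓ : ℕ × Bool → Letter := fun d => if d.2 then lab d.1 else (lab d.1).inv with hℓ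
  have hmem : ∀ z : ℕ × Bool, z ∈ [O, I].flatten ↔ z.1 < n := by
    rintro ⟨i, _ | _⟩ <;> simp [hI, hO]
  refine ⟨ℓ, fun d => (d.1, !d.2), I, O, ⟨?_, ?_, ?_, ?_, ?_, ?_⟩, ?_, ?_⟩
  · simp only [List.flatten_cons, List.flatten_nil, List.append_nil]
    refine List.Nodup.append ?_ ?_ ?_
    · rw [hO, List.nodup_reverse]
      exact List.nodup_range.map fun a b h => (Prod.mk.inj h).1
    · exact List.nodup_range.map fun a b h => (Prod.mk.inj h).1
    · intro z h1 h2
      simp only [hO, hI, List.mem_reverse, List.mem_map] at h1 h2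
      obtain ⟨i, _, rfl⟩ := h1
      obtain ⟨j, _, h⟩ := h2
      simp at h
  · intro d hd
    rw [hmem] at hd ⊢
    exact hd
  · simp
  · rintro ⟨i, _ | _⟩ _ <;> simp
  · rintro ⟨i, _ | _⟩ _ <;> simp [hℓ]
  · intro c h1 h2
    simp only [hmem] at h1 ⊢
    set S : ℕ → ℚ := fun k => ((List.range k).map fun i => c (i, true)).sum with hS
    have hSs : ∀ k, S (k + 1) = S k + c (k, true) := fun k => by simp [hS, List.range_succ]
    have hc : ∀ i, i < n → c (i, false) = - c (i, true) := fun i hi => h1 (i, true) hi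
    refine ⟨fun d => if d.2 then S d.1 else S (d.1 + 1), ?_, ?_⟩
    · rintro ⟨i, _ | _⟩ hi
      · simp [hSs, hc i hi]
      · simp [hSs]
    · intro A hA
      rw [List.mem_cons, List.mem_singleton] at hA
      rcases hA with rfl | rfl
      · refine ⟨S n, ?_⟩
        have key : ∀ k, k ≤ n → IntegratesFrom
            (fun d : ℕ × Bool => if d.2 then S d.1 else S (d.1 + 1)) c
            (S k) ((List.range k).map fun i => (i, false)).reverse := by
          intro k
          induction k with
          | zero => simp
          | succ k ih =>
            intro hk
            simp only [List.range_succ, List.map_append, List.reverse_append, List.map_cons,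
              List.map_nil, List.reverse_singleton, List.singleton_append, integratesFrom_cons]
            refine ⟨by simp, (ih (by omega)).cast ?_⟩
            rw [hSs, hc k (by omega)]; ring
        exact key n le_rfl
      · refine ⟨0, ?_⟩
        have key : ∀ k, IntegratesFrom (fun d : ℕ × Bool => if d.2 then S d.1 else S (d.1 + 1)) c
            0 ((List.range k).map fun i => (i, true)) := by
          intro k
          induction k with
          | zero => simp
          | succ k ih =>
            simp only [List.range_succ, List.map_append, integratesFrom_append]
            refine ⟨ih, ?_⟩
            simp [hS, Function.comp_def]
        exact key n
  · rw [hI, List.map_map]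
    exact hv
  · rw [hO, List.map_reverse, List.map_map, invRev]
    conv_rhs => rw [← hv]
    rw [List.map_map]
    congr 1

namespace IsSpherical

variable {D : Type*} {ℓ : D → Letter} {α : D → D} {fs : List (List D)}

/-- A face with fillable label can be subdivided into faces labelled by relators. -/
theorem fill {P : List Letter → Prop} {v : List Letter} (hv : Fillable P v) :
    ∀ {α : D → D} {R : List D} {fs : List (List D)}, R.map ℓ = v → IsSpherical ℓ α (R :: fs) →
      ∃ α' fs', IsSpherical ℓ α' (fs ++ fs') ∧ ∀ A ∈ fs', P (A.map ℓ) := by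
  induction hv with
  | nil =>
    intro α R fs hR h
    rw [List.map_eq_nil_iff.1 hR] at h
    exact ⟨α, [], by simpa using h.drop_nil, by simp⟩
  | cancel a b l _ ih =>
    intro α R fs hR h
    obtain ⟨A, R', rfl, hA, hR'⟩ := List.map_eq_append_iff.1 hR
    obtain ⟨d, R'', rfl, hd, hR''⟩ := List.map_eq_cons_iff.1 hR'
    obtain ⟨d', B, rfl, hd', hB⟩ := List.map_eq_cons_iff.1 hR''
    obtain ⟨α', h'⟩ := h.fold (by rw [hd', hd])
    exact ih (by rw [List.map_append, hA, hB]) h'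
  | rel a b r hr _ ih =>
    intro α R fs hR h
    obtain ⟨R', B, rfl, hR', hB⟩ := List.map_eq_append_iff.1 hR
    obtain ⟨A, C, rfl, hA, hC⟩ := List.map_eq_append_iff.1 hR'
    obtain ⟨α', fs', h', hfs'⟩ := ih (by rw [List.map_append, hA, hB]) h.pinch
    refine ⟨α', C :: fs', h'.perm ?_, ?_⟩
    · simpa using List.perm_middle.symm
    · intro A hA
      rcases List.mem_cons.1 hA with rfl | hA
      · rwa [hC]
      · exact hfs' A hA

/-- A face whose label is freely trivial can be removed. -/
theorem remove {R : List D} (hR : Fillable (fun _ => False) (R.map ℓ))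
    (h : IsSpherical ℓ α (R :: fs)) : ∃ α', IsSpherical ℓ α' fs := by
  obtain ⟨α', fs', h', hfs'⟩ := fill hR rfl h
  rw [List.eq_nil_iff_forall_not_mem.2 hfs', List.append_nil] at h'
  exact ⟨α', h'⟩

end IsSpherical

/-- The letter given by a letter of the free group on two generators. -/
def toLetter (p : Fin 2 × Bool) : Letter := if p.1 = 0 then none else some p.2

theorem toLetter_not (i : Fin 2) (b : Bool) : toLetter (i, !b) = (toLetter (i, b)).inv := by
  unfold toLetter
  split <;> rfl

theorem map_toLetter_invRev (L : List (Fin 2 × Bool)) :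
    (FreeGroup.invRev L).map toLetter = invRev (L.map toLetter) := by
  simp only [FreeGroup.invRev, invRev, List.map_reverse, List.map_map]
  congr 2
  funext ⟨i, b⟩
  exact toLetter_not i b

theorem IsSpherical.reduce {D : Type*} {ℓ : D → Letter} {fs : List (List D)}
    {L L' : List (Fin 2 × Bool)} (hL : FreeGroup.Red L L') :
    ∀ {α : D → D} {R : List D}, R.map ℓ = L.map toLetter → IsSpherical ℓ α (R :: fs) →
      ∃ α' R', IsSpherical ℓ α' (R' :: fs) ∧ R'.map ℓ = L'.map toLetter := by
  induction hL using Relation.ReflTransGen.head_induction_on with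
  | refl => exact fun hR h => ⟨_, _, h, hR⟩
  | head hst _ ih =>
    intro α R hR h
    cases hst with
    | @not a b i c =>
    rw [List.map_append] at hR
    obtain ⟨A, R', rfl, hA, hR'⟩ := List.map_eq_append_iff.1 hR
    obtain ⟨d, R'', rfl, hd, hR''⟩ := List.map_eq_cons_iff.1 hR'
    obtain ⟨d', B, rfl, hd', hB⟩ := List.map_eq_cons_iff.1 hR''
    obtain ⟨α', h'⟩ := h.fold (by rw [hd', hd]; exact toLetter_not i c)
    exact ih (by rw [List.map_append, List.map_append, hA, hB]) h'

/-- A van Kampen lemma: a reduced word which is a consequence of the relators is the label of a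
face of a spherical map all of whose other faces are labelled by relators. -/
theorem exists_diagram {P : List Letter → Prop} {L L₀ : List (Fin 2 × Bool)}
    (hL : FreeGroup.IsReduced L) (h₀ : FreeGroup.mk L₀ = (FreeGroup.mk L)⁻¹)
    (hP : Fillable P (L₀.map toLetter)) :
    ∃ (ℓ : ℕ × Bool → Letter) (α : ℕ × Bool → ℕ × Bool) (O : List (ℕ × Bool))
      (fs : List (List (ℕ × Bool))), IsSpherical ℓ α (O :: fs) ∧ O.map ℓ = L.map toLetter ∧
        ∀ A ∈ fs, P (A.map ℓ) := by
  obtain ⟨ℓ, α, I, O, h, hI, hO⟩ := exists_isSpherical (L₀.map toLetter)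
  obtain ⟨α₁, fs, h₁, hfs⟩ := IsSpherical.fill hP hI (h.perm (List.Perm.swap _ _ _))
  have hred : FreeGroup.Red (FreeGroup.invRev L₀) L := by
    obtain ⟨M, hM, hM'⟩ := FreeGroup.Red.exact.1
      (show FreeGroup.mk (FreeGroup.invRev L₀) = FreeGroup.mk L by
        rw [← FreeGroup.inv_mk, h₀, inv_inv])
    rwa [← hL.red_iff_eq.1 hM']
  obtain ⟨α₂, O', h₂, hO'⟩ := IsSpherical.reduce hred
    (by rw [hO, map_toLetter_invRev]) (by simpa using h₁)
  exact ⟨ℓ, α₂, O', fs, h₂, hO', hfs⟩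

/-- The exponents of `y` in the word `W²` (for `true`) and in its inverse (for `false`), where
`true` stands for `1` and `false` for `-1`. -/
def exponents : Bool → List Bool
  | true =>
    [true, true, true, true, false, true, false, false, false, true, false, false, true, false,
      true, true, false, false, false, true, true, true, true, false, true, false, false, false,
      true, false, false, true, false, true, true, false, false, false]
  | false =>
    [true, true, true, false, false, true, false, true, true, false, true, true, true, false, true,
      false, false, false, false, true, true, true, false, false, true, false, true, true, false,
      true, true, true, false, true, false, false, false, false]

/-- The word `W²` or a cyclic conjugate of its inverse. -/
def longRelator (s : Bool) : List Letter := (exponents s).flatMap fun e => [none, some e]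

/-- The defining relators `y³` and `W²`, and their inverses. -/
inductive IsRelator : List Letter → Prop
  | short (b : Bool) : IsRelator [some b, some b, some b]
  | long (s : Bool) : IsRelator (longRelator s)

/-- Disjoint subwords of the long relators which are not pieces, given by the position of the first
syllable and the number of syllables. -/
def windows : Bool → List (ℕ × ℕ)
  | true => [(0, 4), (4, 6), (10, 9), (19, 4), (23, 6), (29, 9)]
  | false => [(0, 9), (9, 6), (15, 4), (19, 9), (28, 6), (34, 4)]

theorem length_longRelator (s : Bool) : (longRelator s).length = 76 := by
  cases s <;> rfl

theorem three_le_of_mem_windows : ∀ s, ∀ w ∈ windows s, 3 ≤ w.2 := by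
  decide

/-- The windows are not pieces. -/
theorem windows_nonpiece : ∀ s, ∀ w ∈ windows s, ∀ s' : Bool, ∀ q < 76,
    (∀ t < 2 * w.2, (longRelator s').getD ((q + t) % 76) none =
      ((longRelator s).getD ((2 * w.1 + (2 * w.2 - 1 - t)) % 76) none).inv) →
    s' = !s ∧ (q + (2 * w.1 + (2 * w.2 - 1))) % 38 = 0 := by
  decide +kernel

theorem longRelator_mirror : ∀ s : Bool, ∀ q < 76, ∀ k < 76, (q + k) % 38 = 0 →
    (longRelator (!s)).drop (q + 1) ++ (longRelator (!s)).take q =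
      invRev ((longRelator s).drop (k + 1) ++ (longRelator s).take k) := by
  decide +kernel

theorem windows_run : ∀ s, ∀ w ∈ windows s, ∃ t₀ < 2 * w.2 - 5, ∃ e : Bool, ∀ t < 6,
    (longRelator s).getD ((2 * w.1 + (2 * w.2 - 1 - (t₀ + t))) % 76) none ≠ some e := by
  decide +kernel

theorem longRelator_getD_eq_none : ∀ s, ∀ k < 76,
    ((longRelator s).getD k none = none ↔ k % 2 = 0) := by
  decide +kernel

/-- The quotient by the cycles of a permutation without fixed points has few elements. -/
theorem six_mul_card_cycles_le {X : Type*} [Fintype X] [DecidableEq X] (σ : Equiv.Perm X)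
    (hσ : ∀ d, σ d ≠ d) :
    6 * Nat.card (Quotient (Equiv.Perm.SameCycle.setoid σ)) +
      (∑ d, if σ (σ d) = d then 0 else 1) ≤ 3 * Fintype.card X := by
  classical
  set Q := Quotient (Equiv.Perm.SameCycle.setoid σ)
  have : Fintype Q := Fintype.ofFinite Q
  rw [Nat.card_eq_fintype_card]
  set b : X → ℕ := fun d => if σ (σ d) = d then 0 else 1 with hb
  have hb1 : ∀ d, b d ≤ 1 := fun d => by simp only [hb]; split <;> omega
  have key : ∀ q : Q, 6 ≤ ∑ d with (Quotient.mk _ d : Q) = q, (3 - b d) := by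
    intro q
    obtain ⟨d, rfl⟩ := Quotient.exists_rep q
    have m1 : (Quotient.mk _ (σ d) : Q) = Quotient.mk _ d :=
      Quotient.sound (Equiv.Perm.sameCycle_apply_left.2 (Equiv.Perm.SameCycle.refl σ d))
    have m2 : (Quotient.mk _ (σ (σ d)) : Q) = Quotient.mk _ d :=
      Quotient.sound (Equiv.Perm.sameCycle_apply_left.2
        (Equiv.Perm.sameCycle_apply_left.2 (Equiv.Perm.SameCycle.refl σ d)))
    by_cases h : σ (σ d) = d
    · calc 6 = ∑ z ∈ {d, σ d}, (3 - b z) := by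
            rw [Finset.sum_pair (hσ d).symm]; simp [hb, h]
        _ ≤ _ := Finset.sum_le_sum_of_subset (by
            intro z hz
            simp only [Finset.mem_insert, Finset.mem_singleton] at hz
            rcases hz with rfl | rfl <;> simp [m1])
    · calc 6 ≤ ∑ z ∈ {d, σ d, σ (σ d)}, (3 - b z) := by
            rw [Finset.sum_insert (by simp [(hσ d).symm, Ne.symm h]),
              Finset.sum_pair (hσ (σ d)).symm]
            have := hb1 d; have := hb1 (σ d); have := hb1 (σ (σ d)); omega
        _ ≤ _ := Finset.sum_le_sum_of_subset (by
            intro z hz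
            simp only [Finset.mem_insert, Finset.mem_singleton] at hz
            rcases hz with rfl | rfl | rfl <;> simp [m1, m2])
  have h1 : 6 * Fintype.card Q ≤ ∑ d, (3 - b d) := by
    rw [← Finset.sum_fiberwise (s := Finset.univ) (g := fun d => (Quotient.mk _ d : Q))]
    calc 6 * Fintype.card Q = ∑ _q : Q, 6 := by simp [mul_comm]
      _ ≤ _ := Finset.sum_le_sum fun q _ => key q
  have h2 : ∑ d, (3 - b d) + ∑ d, b d = 3 * Fintype.card X := by
    rw [← Finset.sum_add_distrib, Finset.sum_congr rfl (g := fun _ => 3)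
      (fun d _ => by have := hb1 d; omega)]
    simp [mul_comm]
  change 6 * Fintype.card Q + ∑ d, b d ≤ _
  omega

/-- Euler's inequality for a map on a surface with vanishing first cohomology. -/
theorem card_add_four_le {X κ : Type*} [Fintype X] [Nonempty X] [Fintype κ] [DecidableEq κ]
    (φ α : Equiv.Perm X) (face : X → κ) (hα : ∀ d, α (α d) = d)
    (hne : ∀ d, α d ≠ d)
    (exact : ∀ c : X → ℚ, (∀ d, c (α d) = - c d) → (∀ k, ∑ d with face d = k, c d = 0) →
      ∃ f : X → ℚ, (∀ d, f (α d) = f d + c d) ∧ ∀ d, f (φ d) = f d + c d) :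
    Fintype.card X + 4 ≤
      2 * Nat.card (Quotient (Equiv.Perm.SameCycle.setoid (α.trans φ))) +
        2 * Fintype.card κ := by
  classical
  set σ : Equiv.Perm X := α.trans φ with hσ
  set Q := Quotient (Equiv.Perm.SameCycle.setoid σ)
  have : Fintype Q := Fintype.ofFinite Q
  rw [Nat.card_eq_fintype_card]
  let T : (X → ℚ) →ₗ[ℚ] (X → ℚ) := LinearMap.id - LinearMap.funLeft ℚ ℚ α
  have hT : ∀ c d, T c d = c d - c (α d) := fun c d => rfl
  let A : Submodule ℚ (X → ℚ) :=
    { carrier := {c | ∀ d, c (α d) = - c d}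
      add_mem' := fun {a b} ha hb d => by simp [ha d, hb d]; ring
      zero_mem' := by simp
      smul_mem' := fun r a ha d => by simp [ha d] }
  have hA : ∀ c, c ∈ A ↔ ∀ d, c (α d) = - c d := fun c => Iff.rfl
  have hTA : LinearMap.range T ≤ A := by
    rintro _ ⟨c, rfl⟩ d
    rw [hT, hT, hα]; ring
  let e := Fintype.equivFin X
  let ε : X → ℚ := fun d => if e d < e (α d) then 1 else -1
  have hε : ∀ d, ε (α d) = - ε d := by
    intro d
    simp only [ε, hα]
    have : e (α d) ≠ e d := fun h => hne d (e.injective h)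
    rcases lt_or_gt_of_ne this with h | h
    · simp [h, h.not_gt]
    · simp [h, h.not_gt]
  have hε0 : ∀ d, ε d ≠ 0 := fun d => by simp only [ε]; split <;> norm_num
  have hker : Module.finrank ℚ (LinearMap.ker T) ≤ Module.finrank ℚ A := by
    let M : LinearMap.ker T →ₗ[ℚ] A :=
      { toFun := fun s => ⟨fun d => ε d * s.1 d, fun d => by
          have := congrFun (LinearMap.mem_ker.1 s.2) d
          rw [hT, Pi.zero_apply, sub_eq_zero] at this
          change ε (α d) * s.1 (α d) = - (ε d * s.1 d)
          rw [hε, ← this]; ring⟩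
        map_add' := fun s t => by ext d; simp [mul_add]
        map_smul' := fun r s => by ext d; simp; ring }
    refine LinearMap.finrank_le_finrank_of_injective (f := M) ?_
    intro s t hst
    ext d
    have := congrFun (congrArg Subtype.val hst) d
    exact mul_left_cancel₀ (hε0 d) this
  have h1 : Fintype.card X ≤ 2 * Module.finrank ℚ A := by
    have := LinearMap.finrank_range_add_finrank_ker T
    rw [Module.finrank_fintype_fun_eq_card] at this
    have := Submodule.finrank_mono hTA
    omega
  let d₁ : A →ₗ[ℚ] (κ → ℚ) :=
    { toFun := fun c k => ∑ d with face d = k, c.1 d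
      map_add' := fun a b => by ext k; simp [Finset.sum_add_distrib]
      map_smul' := fun r a => by ext k; simp [Finset.mul_sum] }
  let d₀ : (Q → ℚ) →ₗ[ℚ] A :=
    { toFun := fun h => ⟨fun d => h (Quotient.mk _ (α d)) - h (Quotient.mk _ d), fun d => by
        change h (Quotient.mk _ (α (α d))) - _ = - (_ - _)
        rw [hα]; ring⟩
      map_add' := fun a b => by ext d; simp; ring
      map_smul' := fun r a => by ext d; simp; ring }
  have hex : LinearMap.ker d₁ ≤ LinearMap.range d₀ := by
    intro c hc
    obtain ⟨f, hf, hf'⟩ := exact c.1 c.2 (fun k => congrFun (LinearMap.mem_ker.1 hc) k)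
    have hinv : ∀ d, f (σ d) = f d := fun d => by
      change f (φ (α d)) = f d
      rw [hf', hf, c.2 d]; ring
    have hcyc : ∀ a b, σ.SameCycle a b → f a = f b := by
      rintro a b ⟨k, rfl⟩
      induction k with
      | zero => simp
      | succ n ih => rw [ih, add_comm, zpow_add, zpow_one, Equiv.Perm.mul_apply, hinv]
      | pred n ih =>
        rw [ih, ← hinv ((σ ^ (-(n : ℤ) - 1)) a), ← Equiv.Perm.mul_apply, ← zpow_one_add]
        congr 3; ring
    refine ⟨fun q => Quotient.lift f hcyc q, ?_⟩
    ext d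
    change f (α d) - f d = c.1 d
    rw [hf]; ring
  have hd₁ : Module.finrank ℚ (LinearMap.range d₁) < Fintype.card κ := by
    rw [← Module.finrank_fintype_fun_eq_card (R := ℚ)]
    refine Submodule.finrank_lt fun htop => ?_
    obtain ⟨d⟩ := ‹Nonempty X›
    have : (Pi.single (face d) 1 : κ → ℚ) ∈ LinearMap.range d₁ := htop ▸ Submodule.mem_top
    obtain ⟨c, hc⟩ := this
    have hs : ∑ k, d₁ c k = ∑ z, c.1 z := Finset.sum_fiberwise _ _ _
    have hz : ∑ z, c.1 z = - ∑ z, c.1 z := by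
      conv_lhs => rw [← Equiv.sum_comp α]
      rw [← Finset.sum_neg_distrib]
      exact Finset.sum_congr rfl fun z _ => c.2 z
    rw [hc, Finset.sum_pi_single' ] at hs
    simp at hs
    linarith
  have hd₀ : Module.finrank ℚ (LinearMap.range d₀) < Fintype.card Q := by
    have h := LinearMap.finrank_range_add_finrank_ker d₀
    rw [Module.finrank_fintype_fun_eq_card] at h
    have : 0 < Module.finrank ℚ (LinearMap.ker d₀) := by
      rw [Module.finrank_pos_iff_exists_ne_zero]
      refine ⟨⟨fun _ => 1, ?_⟩, fun h => ?_⟩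
      · rw [LinearMap.mem_ker]
        ext d
        exact sub_self (1 : ℚ)
      · obtain ⟨d⟩ := ‹Nonempty X›
        have := congrFun (congrArg Subtype.val h) (Quotient.mk _ d)
        simp at this
    omega
  have h2 := LinearMap.finrank_range_add_finrank_ker d₁
  have h3 := Submodule.finrank_mono hex
  omega

/-- Combinatorial Gauss–Bonnet inequality: vertices of degree at least three are scarce. -/
theorem sum_add_twelve_le {X κ : Type*} [Fintype X] [DecidableEq X] [Nonempty X] [Fintype κ]
    [DecidableEq κ] (φ α : Equiv.Perm X) (face : X → κ) (hα : ∀ d, α (α d) = d)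
    (hne : ∀ d, α d ≠ d) (hσ : ∀ d, φ (α d) ≠ d)
    (exact : ∀ c : X → ℚ, (∀ d, c (α d) = - c d) → (∀ k, ∑ d with face d = k, c d = 0) →
      ∃ f : X → ℚ, (∀ d, f (α d) = f d + c d) ∧ ∀ d, f (φ d) = f d + c d) :
    (∑ d, if φ (α (φ (α d))) = d then 0 else 1) + 12 ≤ 6 * Fintype.card κ := by
  have h1 := card_add_four_le φ α face hα hne exact
  have h2 : 6 * Nat.card (Quotient (Equiv.Perm.SameCycle.setoid (α.trans φ))) +
      (∑ d, if φ (α (φ (α d))) = d then 0 else 1) ≤ 3 * Fintype.card X :=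
    six_mul_card_cycles_le (α.trans φ : Equiv.Perm X) hσ
  omega

/-- Words in which the letter `x` occupies exactly the even positions. -/
structure IsAlternating (w : List Letter) : Prop where
  even : 2 ∣ w.length
  getD_eq_none : ∀ k < w.length, (w.getD k none = none ↔ k % 2 = 0)

/-- Nonempty alternating words in which both `y` and `y⁻¹` occur in each cyclic subword of
length six. -/
structure IsMixed (w : List Letter) : Prop extends IsAlternating w where
  ne_nil : w ≠ []
  exists_eq : ∀ (k : ℕ) (e : Bool), ∃ t < 6, w.getD ((k + t) % w.length) none = some e

theorem isAlternating_longRelator (s : Bool) : IsAlternating (longRelator s) :=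
  ⟨by rw [length_longRelator]; norm_num, by
    rw [length_longRelator]; exact longRelator_getD_eq_none s⟩

/-- The cyclic word `w` read from after position `k`, with the letter at `k` omitted. -/
def complement (w : List Letter) (k : ℕ) : List Letter := w.drop (k + 1) ++ w.take k

variable {ι : Type*} (word : ι → List Letter)

/-- The darts of a map with given face labels. -/
abbrev Dart : Type _ := Σ i, Fin (word i).length

variable {word}

/-- The label of a dart. -/
def Dart.letter (z : Dart word) : Letter := (word z.1)[z.2]

variable (word) in
/-- The permutation sending each dart to the next one on its face. -/
def next : Equiv.Perm (Dart word) := Equiv.sigmaCongrRight fun _ => finRotate _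

/-- The dart at position `k`, taken cyclically, on the face `i`. -/
def Dart.at (hn : ∀ i, 0 < (word i).length) (i : ι) (k : ℕ) : Dart word :=
  ⟨i, ⟨k % (word i).length, Nat.mod_lt _ (hn i)⟩⟩

@[simp] theorem fst_next (z : Dart word) : (next word z).1 = z.1 := rfl

theorem finRotate_mk {n : ℕ} (hn : 0 < n) (k : ℕ) :
    finRotate n ⟨k % n, Nat.mod_lt _ hn⟩ = ⟨(k + 1) % n, Nat.mod_lt _ hn⟩ := by
  obtain ⟨n, rfl⟩ := Nat.exists_eq_succ_of_ne_zero hn.ne'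
  rw [finRotate_apply]
  ext
  simp [Fin.val_add, Nat.add_mod]

section

variable (hn : ∀ i, 0 < (word i).length)
include hn

theorem next_at (i : ι) (k : ℕ) :
    next word (Dart.at hn i k) = Dart.at hn i (k + 1) := by
  simp only [next, Dart.at, Equiv.sigmaCongrRight_apply, finRotate_mk (hn i)]

theorem at_val (z : Dart word) : Dart.at hn z.1 z.2 = z := by
  obtain ⟨i, k⟩ := z
  simp [Dart.at, Nat.mod_eq_of_lt k.2]

theorem at_mod (i : ι) (k : ℕ) : Dart.at hn i (k % (word i).length) = Dart.at hn i k := by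
  simp [Dart.at]

theorem letter_at (i : ι) (k : ℕ) :
    (Dart.at hn i k).letter = (word i).getD (k % (word i).length) none := by
  have := Nat.mod_lt k (hn i)
  simp [Dart.at, Dart.letter, List.getD_eq_getElem?_getD, this]

theorem IsAlternating.letter_at_eq_none {i : ι} (hi : IsAlternating (word i)) (k : ℕ) :
    (Dart.at hn i k).letter = none ↔ k % 2 = 0 := by
  rw [letter_at, hi.getD_eq_none _ (Nat.mod_lt _ (hn i)), Nat.mod_mod_of_dvd _ hi.even]

theorem IsAlternating.letter_next {z : Dart word} (hz : IsAlternating (word z.1)) :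
    (next word z).letter = none ↔ z.letter ≠ none := by
  rw [← at_val hn z, next_at, hz.letter_at_eq_none hn, Ne, hz.letter_at_eq_none hn]
  omega

end

/-- The word labels a triangle `y³` or `y⁻³`. -/
def IsTriangle (w : List Letter) : Prop := ∃ b : Bool, w = [some b, some b, some b]

theorem IsRelator.isTriangle_or {w : List Letter} (hw : IsRelator w) :
    IsTriangle w ∨ ∃ s, w = longRelator s := by
  cases hw with
  | short b => exact Or.inl ⟨b, rfl⟩
  | long s => exact Or.inr ⟨s, rfl⟩

theorem IsTriangle.not_isAlternating {w : List Letter} (hw : IsTriangle w) :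
    ¬ IsAlternating w := by
  rintro ⟨h, -⟩
  obtain ⟨b, rfl⟩ := hw
  norm_num at h

theorem letter_eq_some {z : Dart word} {b : Bool} (h : word z.1 = [some b, some b, some b]) :
    z.letter = some b := by
  have : z.letter ∈ word z.1 := List.getElem_mem _
  rw [h] at this
  simpa using this

theorem IsTriangle.letter_ne {z : Dart word} (h : IsTriangle (word z.1)) : z.letter ≠ none := by
  obtain ⟨b, hb⟩ := h
  simp [letter_eq_some hb]

theorem Letter.inv_eq_none {l : Letter} : l.inv = none ↔ l = none := by
  rcases l with _ | _ <;> simp [Letter.inv]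

theorem complement_triangle {w : List Letter} {b : Bool} (hw : w = [some b, some b, some b])
    {k : ℕ} (hk : k < 3) : complement w k = [some b, some b] := by
  subst hw
  interval_cases k <;> rfl

/-- Reduced diagrams over the relators: the outer face `o` carries a mixed word, all other faces
carry relators, and no two of them can be cancelled against each other. -/
structure IsReducedMap (o : ι) (α : Equiv.Perm (Dart word)) : Prop where
  outer : IsMixed (word o)
  rel : ∀ i, i ≠ o → IsRelator (word i)
  invol : ∀ d, α (α d) = d
  map_ne : ∀ d, α d ≠ d
  letter : ∀ d, (α d).letter = d.letter.inv
  reduced : ∀ d, d.1 ≠ o → (α d).1 ≠ o → (α d).1 ≠ d.1 →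
    complement (word (α d).1) (α d).2 ≠ invRev (complement (word d.1) d.2)

namespace IsReducedMap

variable {o : ι} {α : Equiv.Perm (Dart word)} (h : IsReducedMap o α)
include h

theorem alternating_or_triangle (i : ι) :
    IsAlternating (word i) ∨ IsTriangle (word i) := by
  by_cases hi : i = o
  · exact Or.inl (hi ▸ h.outer.toIsAlternating)
  · have := h.rel i hi
    generalize word i = w at this ⊢
    cases this with
    | short b => exact Or.inr ⟨b, rfl⟩
    | long s => exact Or.inl (isAlternating_longRelator s)

theorem ne_outer {i : ι} (hi : IsTriangle (word i)) : i ≠ o := by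
  rintro rfl
  exact hi.not_isAlternating h.outer.toIsAlternating

theorem pos (i : ι) : 0 < (word i).length := by
  by_cases hi : i = o
  · exact hi ▸ List.length_pos_iff.2 h.outer.ne_nil
  · have := h.rel i hi
    generalize word i = w at this ⊢
    cases this with
    | short b => simp
    | long s => simp [length_longRelator]

theorem next_ne (d : Dart word) : next word (α d) ≠ d := by
  intro hd
  have h1 : (next word (α d)).letter = (α d).letter.inv := by
    rw [hd, h.letter]; simp
  rcases h.alternating_or_triangle (α d).1 with ha | ⟨b, hb⟩
  · have h2 := ha.letter_next h.pos
    rw [h1, Letter.inv_eq_none] at h2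
    tauto
  · rw [letter_eq_some hb, letter_eq_some (b := b) (by simpa using hb)] at h1
    cases b <;> simp [Letter.inv] at h1

theorem not_triangle {d : Dart word} (hd : IsTriangle (word d.1)) :
    ¬ IsTriangle (word (α d).1) := by
  intro hd'
  have o1 := h.ne_outer hd
  have o2 := h.ne_outer hd'
  obtain ⟨b, hb⟩ := hd
  obtain ⟨b', hb'⟩ := hd'
  have hl := h.letter d
  rw [letter_eq_some hb, letter_eq_some hb'] at hl
  have hbb : b' = !b := by simpa [Letter.inv] using hl
  have k1 : (d.2 : ℕ) < 3 := by have := d.2.2; simpa [hb] using this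
  have k2 : ((α d).2 : ℕ) < 3 := by have := (α d).2.2; simpa [hb'] using this
  refine h.reduced d o1 o2 (fun hf => ?_) ?_
  · rw [hf, hb, hbb] at hb'
    simp at hb'
  · rw [complement_triangle hb' k2, complement_triangle hb k1, hbb]
    rfl

theorem next_of_next_eq {e : Dart word}
    (he : next word (α (next word (α (next word e)))) = next word e) :
    next word (α (next word e)) = α e := by
  have := (next word).injective he
  rw [← this, h.invol, this]

/-- A vertex on a triangle has degree at least three. -/
theorem next_ne_of_triangle {d : Dart word} (hd : IsTriangle (word d.1)) :
    next word (α (next word (α d))) ≠ d := by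
  obtain ⟨e, rfl⟩ := (next word).surjective d
  intro hc
  have h1 := h.next_of_next_eq hc
  have hdd : IsTriangle (word e.1) := hd
  have hf : (α (next word e)).1 = (α e).1 := by rw [← h1]; rfl
  have ha : IsAlternating (word (α (next word e)).1) := by
    rw [hf]; exact (h.alternating_or_triangle _).resolve_right (h.not_triangle hdd)
  have h2 := ha.letter_next h.pos
  rw [h1, h.letter, h.letter, Letter.inv_eq_none, Ne, Letter.inv_eq_none] at h2
  have h3 := hd.letter_ne
  have h4 := hdd.letter_ne
  tauto

theorem alternating_of_triangle {d : Dart word} (hd : IsTriangle (word (α d).1)) :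
    IsAlternating (word d.1) := by
  refine (h.alternating_or_triangle _).resolve_right ?_
  have := h.not_triangle hd
  rwa [h.invol] at this

theorem letter_ne_of_triangle {d : Dart word} (hd : IsTriangle (word (α d).1)) :
    d.letter ≠ none := by
  have := hd.letter_ne
  rwa [h.letter, Ne, Letter.inv_eq_none] at this

theorem next_ne_of_adj_triangle {d : Dart word} (hd : IsTriangle (word (α d).1)) :
    next word (α (next word (α d))) ≠ d := by
  have ha := h.alternating_of_triangle hd
  have hl := h.letter_ne_of_triangle hd
  obtain ⟨e, rfl⟩ := (next word).surjective d
  intro hc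
  have h1 := h.next_of_next_eq hc
  have hf : (α e).1 = (α (next word e)).1 := by rw [← h1]; rfl
  rw [← hf] at hd
  have h2 := IsAlternating.letter_next h.pos (z := e) ha
  have := h.letter_ne_of_triangle hd
  tauto

theorem next_ne_of_adj_triangle' {d : Dart word} (hd : IsTriangle (word (α d).1)) :
    next word (α (next word (α (next word d)))) ≠ next word d := by
  intro hc
  have h1 := h.next_of_next_eq hc
  have hf : (α (next word d)).1 = (α d).1 := by rw [← h1]; rfl
  have ha := h.alternating_of_triangle hd
  have hl := h.letter_ne_of_triangle hd
  have := h.letter_ne_of_triangle (d := next word d) (by rwa [hf])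
  have h2 := ha.letter_next h.pos
  tauto

/-- Each window contains an interior vertex of degree at least three. -/
theorem exists_next_ne {i : ι} (hi : i ≠ o) {s : Bool} (hs : word i = longRelator s)
    {w : ℕ × ℕ} (hw : w ∈ windows s) : ∃ j < 2 * w.2 - 1,
      next word (α (next word (α (Dart.at h.pos i (2 * w.1 + 1 + j))))) ≠
        Dart.at h.pos i (2 * w.1 + 1 + j) := by
  by_contra! hc
  have hm := three_le_of_mem_windows s w hw
  set m := 2 * w.2 with hm_def
  set z : ℕ → Dart word := fun t => α (Dart.at h.pos i (2 * w.1 + (m - 1 - t))) with hz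
  set f := (z 0).1 with hf
  set q : ℕ := (z 0).2.val with hq
  have hzq : ∀ t < m, z t = Dart.at h.pos f (q + t) := by
    intro t
    induction t with
    | zero => intro _; rw [add_zero, hf, hq, at_val]
    | succ t ih =>
      intro ht
      have h1 := hc (m - 1 - (t + 1)) (by omega)
      have e1 : 2 * w.1 + 1 + (m - 1 - (t + 1)) = 2 * w.1 + (m - 1 - (t + 1)) + 1 := by omega
      rw [e1, ← next_at] at h1
      have h2 := h.next_of_next_eq h1
      rw [next_at] at h2
      have e2 : 2 * w.1 + (m - 1 - (t + 1)) + 1 = 2 * w.1 + (m - 1 - t) := by omega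
      rw [e2] at h2
      rw [← add_assoc, ← next_at, ← ih (by omega)]
      exact h2.symm
  have hlab : ∀ t < m, (word f).getD ((q + t) % (word f).length) none =
      ((longRelator s).getD ((2 * w.1 + (m - 1 - t)) % 76) none).inv := by
    intro t ht
    rw [← letter_at h.pos, ← hzq t ht, h.letter, letter_at, hs, length_longRelator]
  have hfa : IsAlternating (word f) := by
    refine (h.alternating_or_triangle f).resolve_right fun ht => ?_
    have h1 := hzq (m - 1) (by omega)
    have h2 : (z (m - 1)).letter = none := by
      rw [hz, h.letter, Letter.inv_eq_none,
        IsAlternating.letter_at_eq_none h.pos (by rw [hs]; exact isAlternating_longRelator s)]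
      omega
    rw [h1] at h2
    exact IsTriangle.letter_ne (z := Dart.at h.pos f (q + (m - 1))) ht h2
  have hfo : f ≠ o := by
    intro hfo
    obtain ⟨t₀, ht₀, e, he⟩ := windows_run s w hw
    obtain ⟨t, ht, h1⟩ := (hfo ▸ h.outer).exists_eq (q + t₀) (!e)
    rw [add_assoc, hlab _ (by omega)] at h1
    refine he t ht ?_
    rw [← Letter.inv_inv (List.getD _ _ _), h1]
    simp [Letter.inv]
  obtain ⟨s', hs'⟩ : ∃ s', word f = longRelator s' := by
    have := h.rel f hfo
    generalize word f = v at this hfa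
    cases this with
    | short b => exact absurd hfa (IsTriangle.not_isAlternating ⟨b, rfl⟩)
    | long s' => exact ⟨s', rfl⟩
  have hq76 : q < 76 := by
    have : q < (word f).length := (z 0).2.2
    rwa [hs', length_longRelator] at this
  rw [hs', length_longRelator] at hlab
  obtain ⟨rfl, hmir⟩ := windows_nonpiece s w hw s' q hq76 hlab
  set d := Dart.at h.pos i (2 * w.1 + (m - 1)) with hd
  have hk : (d.2 : ℕ) = (2 * w.1 + (m - 1)) % 76 := by
    change _ % (word i).length = _
    rw [hs, length_longRelator]
  refine h.reduced d hi hfo ?_ ?_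
  · intro hfi
    have : word f = word i := congrArg word hfi
    rw [hs', hs] at this
    revert this
    cases s <;> decide
  · have e1 : word (α d).1 = longRelator (!s) := hs'
    have e2 : word d.1 = longRelator s := hs
    rw [congrArg (complement · _) e1, congrArg (complement · _) e2]
    exact longRelator_mirror s _ hq76 _ (by rw [hk]; omega) (by rw [hk]; omega)

end IsReducedMap

theorem sum_range_seventy_six (b : ℕ → ℕ) (hb : b 76 = b 0) :
    ∑ k ∈ Finset.range 76, b k = ∑ i ∈ Finset.range 38, (b (2 * i + 1) + b (2 * i + 2)) := by
  have key : ∀ n, ∑ k ∈ Finset.range (2 * n), b (k + 1) =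
      ∑ i ∈ Finset.range n, (b (2 * i + 1) + b (2 * i + 2)) := by
    intro n
    induction n with
    | zero => rfl
    | succ n ih =>
      rw [Nat.mul_succ, Finset.sum_range_succ, Finset.sum_range_succ, Finset.sum_range_succ, ih]
      ring
  rw [← key 38]
  have h1 := Finset.sum_range_succ b 76
  have h2 := Finset.sum_range_succ' b 76
  change _ = ∑ k ∈ Finset.range 76, b (k + 1)
  omega

theorem six_le_sum (s : Bool) (e : ℕ → ℕ)
    (he : ∀ w ∈ windows s, ∃ i < w.2, 1 ≤ e (w.1 + i)) : 6 ≤ ∑ i ∈ Finset.range 38, e i := by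
  have key : ∀ w ∈ windows s, 1 ≤ ∑ i ∈ Finset.range w.2, e (w.1 + i) := by
    intro w hw
    obtain ⟨i, hi, h1⟩ := he w hw
    exact h1.trans (Finset.single_le_sum (f := fun i => e (w.1 + i)) (fun _ _ => Nat.zero_le _)
      (Finset.mem_range.2 hi))
  cases s <;>
  · simp only [windows, List.forall_mem_cons, Finset.sum_range_succ, Finset.sum_range_zero,
      Nat.reduceAdd, Nat.add_zero] at key
    simp only [Finset.sum_range_succ, Finset.sum_range_zero]
    omega

/-- The numerical part of the curvature estimate on a long face. -/
theorem six_add_sum_le (s : Bool) (b t : ℕ → ℕ) (hb : b 76 = b 0) (ht : t 76 = t 0)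
    (ht1 : ∀ k, t k ≤ 1) (ht0 : ∀ k, k % 2 = 0 → t k = 0)
    (hbt : ∀ k, 2 * t k ≤ b k + b (k + 1))
    (hw : ∀ w ∈ windows s, ∃ j < 2 * w.2 - 1, 1 ≤ b (2 * w.1 + 1 + j)) :
    6 + ∑ k ∈ Finset.range 76, t k ≤ ∑ k ∈ Finset.range 76, b k := by
  rw [sum_range_seventy_six b hb, sum_range_seventy_six t ht]
  have h6 := six_le_sum s (fun i => min 1 (b (2 * i + 1) + b (2 * i + 2))) (by
    intro w hws
    obtain ⟨j, hj, h1⟩ := hw w hws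
    refine ⟨j / 2, by omega, ?_⟩
    rcases Nat.even_or_odd' j with ⟨c, rfl | rfl⟩
    · have e1 : 2 * (w.1 + 2 * c / 2) + 1 = 2 * w.1 + 1 + 2 * c := by omega
      simp only [e1]; omega
    · have e1 : 2 * (w.1 + (2 * c + 1) / 2) + 2 = 2 * w.1 + 1 + (2 * c + 1) := by omega
      simp only [e1]; omega)
  refine (Nat.add_le_add_right h6 _).trans ?_
  rw [← Finset.sum_add_distrib]
  refine Finset.sum_le_sum fun i _ => ?_
  have h1 := ht1 (2 * i + 1)
  have h2 := hbt (2 * i + 1)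
  have h3 := ht0 (2 * i + 2) (by omega)
  simp only [h3]
  have e1 : 2 * i + 1 + 1 = 2 * i + 2 := rfl
  rw [e1] at h2
  omega

theorem sum_face (hn : ∀ i, 0 < (word i).length) (g : Dart word → ℕ) (i : ι) :
    ∑ j, g ⟨i, j⟩ = ∑ k ∈ Finset.range (word i).length, g (Dart.at hn i k) := by
  rw [Finset.sum_range]
  exact Finset.sum_congr rfl fun j _ => by rw [← at_val hn ⟨i, j⟩]

namespace IsReducedMap

variable {o : ι} {α : Equiv.Perm (Dart word)} [DecidableEq ι]

open Classical in
/-- There is no reduced map on a surface with vanishing first cohomology. -/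
theorem false_of_exact [Fintype ι] (h : IsReducedMap o α)
    (exact : ∀ c : Dart word → ℚ, (∀ d, c (α d) = - c d) → (∀ i, ∑ j, c ⟨i, j⟩ = 0) →
      ∃ f : Dart word → ℚ, (∀ d, f (α d) = f d + c d) ∧ ∀ d, f (next word d) = f d + c d) :
    False := by
  have : Nonempty (Dart word) := ⟨⟨o, ⟨0, h.pos o⟩⟩⟩
  have h1 := sum_add_twelve_le (next word) α Sigma.fst h.invol h.map_ne h.next_ne (by
    intro c hc hs
    refine exact c hc fun i => ?_
    rw [← hs i, Finset.sum_filter, Fintype.sum_sigma, Finset.sum_eq_single i]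
    · simp
    · intro k _ hk
      simp [hk]
    · simp)
  set b : Dart word → ℕ := fun d => if next word (α (next word (α d))) = d then 0 else 1 with hb
  set t : Dart word → ℕ := fun d => if IsTriangle (word (α d).1) then 1 else 0 with ht
  have hb1 : ∀ d, next word (α (next word (α d))) ≠ d → b d = 1 := fun d hd => by simp [hb, hd]
  have ht1 : ∀ d, t d ≤ 1 := fun d => by simp only [ht]; split <;> omega
  have htb : ∀ d, t d ≤ b d := by
    intro d
    by_cases hd : IsTriangle (word (α d).1)
    · rw [hb1 d (h.next_ne_of_adj_triangle hd)]; exact ht1 d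
    · simp [ht, hd]
  have htb' : ∀ d, t d ≤ b (next word d) := by
    intro d
    by_cases hd : IsTriangle (word (α d).1)
    · rw [hb1 _ (h.next_ne_of_adj_triangle' hd)]; exact ht1 d
    · simp [ht, hd]
  have key : ∀ i, (if i = o then 0 else 6) + ∑ j, t ⟨i, j⟩ ≤
      ∑ j, b ⟨i, j⟩ + ∑ j : Fin (word i).length, if IsTriangle (word i) then 1 else 0 := by
    intro i
    split
    · rw [zero_add]
      exact (Finset.sum_le_sum fun j _ => htb ⟨i, j⟩).trans (Nat.le_add_right _ _)
    · rename_i hi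
      rcases (h.rel i hi).isTriangle_or with htri | ⟨s, hs⟩
      · have hlen : (word i).length = 3 := by
          obtain ⟨c, hc⟩ := htri
          rw [hc]; rfl
        have ht0 : ∀ j, t ⟨i, j⟩ = 0 := fun j => if_neg (h.not_triangle (d := ⟨i, j⟩) htri)
        have hb0 : ∀ j, b ⟨i, j⟩ = 1 := fun j => hb1 _ (h.next_ne_of_triangle (d := ⟨i, j⟩) htri)
        simp [ht0, hb0, htri, hlen]
      · refine le_trans ?_ (Nat.le_add_right _ _)
        have hlen : (word i).length = 76 := by rw [hs, length_longRelator]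
        have h76 : Dart.at h.pos i 76 = Dart.at h.pos i 0 := by
          rw [← at_mod, hlen]
        rw [sum_face h.pos, sum_face h.pos, hlen]
        refine six_add_sum_le s _ _ (congrArg b h76) (congrArg t h76) (fun k => ht1 _) ?_ ?_ ?_
        · intro k hk
          refine if_neg fun hd => h.letter_ne_of_triangle hd ?_
          rwa [IsAlternating.letter_at_eq_none h.pos
            (by rw [hs]; exact isAlternating_longRelator s)]
        · intro k
          have e1 := htb (Dart.at h.pos i k)
          have e2 := htb' (Dart.at h.pos i k)
          rw [next_at] at e2
          omega
        · intro w hw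
          obtain ⟨j, hj, hne⟩ := h.exists_next_ne hi hs hw
          exact ⟨j, hj, (hb1 _ hne).ge⟩
  have hsum : (∑ i, if i = o then 0 else 6) + ∑ z, t z ≤
      ∑ z, b z + ∑ z : Dart word, if IsTriangle (word z.1) then 1 else 0 := by
    rw [Fintype.sum_sigma, Fintype.sum_sigma, Fintype.sum_sigma, ← Finset.sum_add_distrib,
      ← Finset.sum_add_distrib]
    exact Finset.sum_le_sum fun i _ => key i
  have h0 : ∑ z, b z + 12 ≤ 6 * Fintype.card ι := h1
  have h2 : ∑ z, t z = ∑ z : Dart word, if IsTriangle (word z.1) then 1 else 0 :=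
    Equiv.sum_comp α fun z : Dart word => if IsTriangle (word z.1) then 1 else 0
  have h3 : ∑ i : ι, (if i = o then 0 else 6) + 6 = 6 * Fintype.card ι := by
    have : ∀ i, (if i = o then 0 else 6) + (if i = o then 6 else 0) = 6 := fun i => by
      split <;> rfl
    have h4 := Finset.sum_congr rfl fun i (_ : i ∈ Finset.univ) => this i
    rw [Finset.sum_add_distrib, Finset.sum_ite_eq'] at h4
    simpa [mul_comm] using h4
  omega

end IsReducedMap

theorem IntegratesFrom.getElem_eq {D : Type*} {f c : D → ℚ} {g : ℚ} {A : List D}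
    (h : IntegratesFrom f c g A) {k : ℕ} (hk : k < A.length) :
    f A[k] = g + ((A.take k).map c).sum := by
  induction A generalizing g k with
  | nil => simp at hk
  | cons d A ih =>
    cases k with
    | zero => simpa using h.1
    | succ k =>
      have := ih h.2 (k := k) (by simpa using hk)
      simpa [add_assoc] using this

theorem IntegratesFrom.getElem_next {D : Type*} {f c : D → ℚ} {g : ℚ} {A : List D}
    (h : IntegratesFrom f c g A) (hs : (A.map c).sum = 0) {k : ℕ} (hk : k < A.length) :
    f (A[(k + 1) % A.length]'(Nat.mod_lt _ (by omega))) = f A[k] + c A[k] := by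
  have h1 := h.getElem_eq hk
  have h2 : ((A.take (k + 1)).map c).sum = ((A.take k).map c).sum + c A[k] := by
    rw [List.take_succ_eq_append_getElem hk]
    simp only [List.map_append, List.map_cons, List.map_nil, List.sum_append, List.sum_cons,
      List.sum_nil, add_zero]
  rw [h.getElem_eq]
  rcases Nat.lt_or_ge (k + 1) A.length with h3 | h3
  · rw [Nat.mod_eq_of_lt h3, h2, h1]; ring
  · have e : k + 1 = A.length := by omega
    rw [e, List.take_length, hs] at h2
    rw [e, Nat.mod_self, h1]
    simp only [List.take_zero, List.map_nil, List.sum_nil]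
    linarith

section faceDart

variable {D : Type*} (ℓ : D → Letter) (faces : List (List D))

/-- The labels of the faces. -/
def faceWord (i : Fin faces.length) : List Letter := faces[i].map ℓ

/-- The dart of a spherical map at a given position. -/
def faceDart (z : Dart (faceWord ℓ faces)) : D :=
  faces[z.1][z.2.val]'(by simpa [faceWord] using z.2.2)

theorem letter_eq (z : Dart (faceWord ℓ faces)) : z.letter = ℓ (faceDart ℓ faces z) := by
  simp [Dart.letter, faceWord, faceDart]

theorem faceDart_mem (z : Dart (faceWord ℓ faces)) : faceDart ℓ faces z ∈ faces.flatten :=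
  List.mem_flatten.2 ⟨_, List.getElem_mem _, List.getElem_mem _⟩

variable {faces}

theorem exists_faceDart_eq {d : D} (hd : d ∈ faces.flatten) :
    ∃ z, faceDart ℓ faces z = d := by
  obtain ⟨A, hA, hdA⟩ := List.mem_flatten.1 hd
  obtain ⟨i, hi, rfl⟩ := List.getElem_of_mem hA
  obtain ⟨k, hk, rfl⟩ := List.getElem_of_mem hdA
  exact ⟨⟨⟨i, hi⟩, ⟨k, by simpa [faceWord] using hk⟩⟩, rfl⟩

theorem faceDart_injective (h : faces.flatten.Nodup) :
    Function.Injective (faceDart ℓ faces) := by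
  obtain ⟨h1, h2⟩ := List.nodup_flatten.1 h
  rintro ⟨⟨i, hi⟩, ⟨k, hk⟩⟩ ⟨⟨j, hj⟩, ⟨m, hm⟩⟩ hz
  simp only [faceWord, List.length_map, Fin.getElem_fin] at hk hm
  change faces[i][k] = faces[j][m] at hz
  have hij : i = j := by
    by_contra hij
    rcases Nat.lt_or_gt_of_ne hij with hlt | hlt
    · exact List.pairwise_iff_getElem.1 h2 i j hi hj hlt (List.getElem_mem hk)
        (hz ▸ List.getElem_mem hm)
    · exact List.pairwise_iff_getElem.1 h2 j i hj hi hlt (List.getElem_mem hm)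
        (hz ▸ List.getElem_mem hk)
  subst hij
  have hkm := (h1 _ (List.getElem_mem hi)).getElem_inj_iff.1 hz
  subst hkm
  rfl

theorem faceDart_next (z : Dart (faceWord ℓ faces)) :
    ∃ hk : (z.2.val + 1) % faces[z.1].length < faces[z.1].length,
      faceDart ℓ faces (next _ z) = faces[z.1][(z.2.val + 1) % faces[z.1].length]'hk := by
  have hn : 0 < (faceWord ℓ faces z.1).length := Nat.zero_lt_of_lt z.2.2
  have hl : (faceWord ℓ faces z.1).length = faces[z.1].length := List.length_map _
  refine ⟨Nat.mod_lt _ (hl ▸ hn), ?_⟩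
  have h1 : (finRotate _ z.2).val = (z.2.val + 1) % faces[z.1].length := by
    rw [← hl]
    have := congrArg Fin.val (finRotate_mk hn z.2.val)
    simpa only [Nat.mod_eq_of_lt z.2.2] using this
  change faces[z.1][(finRotate _ z.2).val]'_ = _
  simp only [h1]

theorem sum_faceDart (c : D → ℚ) (i : Fin faces.length) :
    ∑ j, c (faceDart ℓ faces ⟨i, j⟩) = (faces[i].map c).sum := by
  rw [← Fin.sum_univ_getElem]
  refine Fintype.sum_equiv (finCongr (by simp [faceWord])) _ _ fun j => ?_
  simp [faceDart]

end faceDart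

theorem exists_perm_cons_cons {β : Type*} {l : List β} {i j : ℕ} (hi : i < l.length)
    (hj : j < l.length) (hij : i ≠ j) : ∃ r, l.Perm (l[i] :: l[j] :: r) := by
  have h1 : l[j] ∈ l.eraseIdx i := List.mem_eraseIdx_iff_getElem.2 ⟨j, hj, hij.symm, rfl⟩
  obtain ⟨s, t, hst⟩ := List.append_of_mem h1
  refine ⟨s ++ t, (List.getElem_cons_eraseIdx_perm hi).symm.trans (List.Perm.cons _ ?_)⟩
  rw [hst]
  exact List.perm_middle

/-- Two faces which are mirror images of each other across an edge can be cancelled. -/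
theorem IsSpherical.cancel {D : Type*} {ℓ : D → Letter} {α : D → D} {F G : List D}
    {fs : List (List D)} (h : IsSpherical ℓ α (F :: G :: fs)) {k m : ℕ} (hk : k < F.length)
    (hm : m < G.length) (hα : α F[k] = G[m])
    (hc : complement (G.map ℓ) m = invRev (complement (F.map ℓ) k)) :
    ∃ α', IsSpherical ℓ α' fs := by
  have eF : F = F.take k ++ F[k] :: F.drop (k + 1) := by
    rw [← List.drop_eq_getElem_cons, List.take_append_drop]
  have eG : G = G.take m ++ G[m] :: G.drop (m + 1) := by
    rw [← List.drop_eq_getElem_cons, List.take_append_drop]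
  have h' := h
  rw [eF, eG] at h'
  refine (h'.merge hα).remove ?_
  simp only [complement, ← List.map_drop, ← List.map_take, ← List.map_append] at hc
  rw [List.map_append, List.map_append, hc, List.map_append, SmallCancellation.invRev_append,
    ← List.append_assoc, List.append_assoc]
  exact (Fillable.append_invRev _).append (Fillable.invRev_append _)

/-- No mixed word is the label of a face of a spherical map whose other faces are labelled by
relators. -/
theorem not_isSpherical {D : Type*} {ℓ : D → Letter} (n : ℕ) : ∀ {α : D → D} {O : List D}
    {fs : List (List D)}, (O :: fs).flatten.length ≤ n → IsMixed (O.map ℓ) →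
    (∀ A ∈ fs, IsRelator (A.map ℓ)) → ¬ IsSpherical ℓ α (O :: fs) := by
  induction n with
  | zero =>
    intro α O fs hn hO _ _
    refine hO.ne_nil ?_
    simp at hn
    simp [hn.1]
  | succ n ih =>
    intro α O fs hn hO hfs h
    set faces := O :: fs with hfaces
    set e := faceDart ℓ faces with he
    have hinj : Function.Injective e := faceDart_injective ℓ h.nodup
    have hmem : ∀ z, e z ∈ faces.flatten := faceDart_mem ℓ faces
    choose a ha using fun z => exists_faceDart_eq ℓ (h.map_mem _ (hmem z))
    have hae : ∀ z, e (a z) = α (e z) := ha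
    have hinv : Function.Involutive a := fun z => hinj (by rw [hae, hae, h.invol _ (hmem z)])
    have hrel : ∀ i : Fin faces.length, i ≠ ⟨0, by simp [hfaces]⟩ → faces[i] ∈ fs := by
      rintro ⟨_ | i, hi⟩ hne
      · exact absurd rfl hne
      · exact List.getElem_mem (l := fs) _
    refine IsReducedMap.false_of_exact (word := faceWord ℓ faces) (o := ⟨0, by simp [hfaces]⟩)
      (α := hinv.toPerm a) ⟨hO, fun i hi => hfs _ (hrel i hi), hinv, ?_, ?_, ?_⟩ ?_
    · intro z hz
      refine h.map_ne _ (hmem z) ?_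
      rw [← hae]
      exact congrArg e hz
    · intro z
      rw [letter_eq, letter_eq, ← h.label _ (hmem z)]
      exact congrArg ℓ (hae z)
    · intro z h1 h2 h3 hc
      obtain ⟨⟨i, hi⟩, k⟩ := z
      obtain ⟨⟨⟨j, hj⟩, m⟩, hz⟩ : ∃ z' : Dart (faceWord ℓ faces),
        z' = a ⟨⟨i, hi⟩, k⟩ := ⟨_, rfl⟩
      rw [show hinv.toPerm a ⟨⟨i, hi⟩, k⟩ = ⟨⟨j, hj⟩, m⟩ from hz.symm] at h2 h3 hc
      have hα : α (e ⟨⟨i, hi⟩, k⟩) = e ⟨⟨j, hj⟩, m⟩ := by rw [← hae, hz]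
      cases i with
      | zero => exact h1 rfl
      | succ i =>
      cases j with
      | zero => exact h2 rfl
      | succ j =>
      have hi' : i < fs.length := by simpa [hfaces] using hi
      have hj' : j < fs.length := by simpa [hfaces] using hj
      obtain ⟨r, hr⟩ := exists_perm_cons_cons hi' hj' (fun hij => h3 (by simp [hij]))
      have hp : faces.Perm (fs[i] :: fs[j] :: O :: r) := by
        refine (hr.cons O).trans ?_
        exact (List.Perm.swap _ _ _).trans ((List.Perm.swap _ _ _).cons _)
      have hk : k.val < fs[i].length := by simpa [faceWord, hfaces] using k.2
      have hm : m.val < fs[j].length := by simpa [faceWord, hfaces] using m.2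
      obtain ⟨α', h'⟩ := (h.perm hp).cancel (k := k) (m := m) hk hm hα hc
      refine ih ?_ hO (fun A hA => hfs A (hr.mem_iff.2 (by simp [hA]))) h'
      have hl := hp.flatten.length_eq
      simp only [List.flatten_cons, List.length_append] at hl hn ⊢
      omega
    · intro c hc hs
      set c' : D → ℚ := Function.extend e c 0 with hc'
      have hce : ∀ z, c' (e z) = c z := fun z => hinj.extend_apply c 0 z
      have hsum : ∀ i : Fin faces.length, (faces[i].map c').sum = 0 := by
        intro i
        rw [← sum_faceDart ℓ, ← hs i]
        exact Finset.sum_congr rfl fun j _ => hce _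
      obtain ⟨f, hf, hA⟩ := h.exact c' (by
        intro d hd
        obtain ⟨z, rfl⟩ := exists_faceDart_eq ℓ hd
        change c' (α (e z)) = - c' (e z)
        rw [← hae, hce, hce]
        exact hc z) (by
        intro A hA
        obtain ⟨i, hi, rfl⟩ := List.getElem_of_mem hA
        exact hsum ⟨i, hi⟩)
      refine ⟨fun z => f (e z), fun z => ?_, fun z => ?_⟩
      · rw [← hce, ← hf _ (hmem z), ← hae]
        rfl
      · obtain ⟨g, hg⟩ := hA faces[z.1] (List.getElem_mem _)
        obtain ⟨hk, h1⟩ := faceDart_next ℓ z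
        have hk' : z.2.val < faces[z.1].length := by simpa [faceWord] using z.2.2
        change f (faceDart ℓ faces _) = f (e z) + c z
        rw [h1, hg.getElem_next (hsum z.1) hk', ← hce z]
        rfl

section fillableSubgroup

variable (P : List Letter → Prop)

/-- The elements of the free group represented by a fillable word. -/
def IsFillable (g : FreeGroup (Fin 2)) : Prop :=
  ∃ v, FreeGroup.mk v = g ∧ Fillable P (v.map toLetter)

variable {P}

theorem IsFillable.mul {g h : FreeGroup (Fin 2)} (hg : IsFillable P g) (hh : IsFillable P h) :
    IsFillable P (g * h) := by
  obtain ⟨v, rfl, hv⟩ := hg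
  obtain ⟨w, rfl, hw⟩ := hh
  exact ⟨v ++ w, rfl, by rw [List.map_append]; exact hv.append hw⟩

theorem IsFillable.conj {g : FreeGroup (Fin 2)} (hg : IsFillable P g) (h : FreeGroup (Fin 2)) :
    IsFillable P (h * g * h⁻¹) := by
  obtain ⟨v, rfl, hv⟩ := hg
  induction h using Quot.inductionOn with
  | h w =>
  refine ⟨w ++ v ++ FreeGroup.invRev w, rfl, ?_⟩
  rw [List.map_append, List.map_append, map_toLetter_invRev]
  exact hv.insert (Fillable.append_invRev _)

variable (P)

/-- The elements of the free group which, together with their inverses, are represented by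
fillable words. -/
def fillableSubgroup : Subgroup (FreeGroup (Fin 2)) where
  carrier := {g | IsFillable P g ∧ IsFillable P g⁻¹}
  one_mem' := by
    rw [Set.mem_ofPred_eq, inv_one, and_self]
    exact ⟨[], rfl, .nil⟩
  mul_mem' := by
    rintro g h ⟨hg, hg'⟩ ⟨hh, hh'⟩
    exact ⟨hg.mul hh, by rw [mul_inv_rev]; exact hh'.mul hg'⟩
  inv_mem' := by
    rintro g ⟨hg, hg'⟩
    exact ⟨hg', by rwa [inv_inv]⟩

instance : (fillableSubgroup P).Normal where
  conj_mem := by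
    rintro g ⟨hg, hg'⟩ h
    refine ⟨hg.conj h, ?_⟩
    rw [mul_inv_rev, mul_inv_rev, inv_inv, ← mul_assoc]
    exact hg'.conj h

end fillableSubgroup

theorem x_sq_mem : x ^ 2 ∈ fillableSubgroup IsRelator :=
  ⟨⟨[(0, true), (0, true)], rfl, .cancel [] [] none .nil⟩,
    ⟨[(0, false), (0, false)], rfl, .cancel [] [] none .nil⟩⟩

theorem y_cube_mem : y ^ 3 ∈ fillableSubgroup IsRelator :=
  ⟨⟨[(1, true), (1, true), (1, true)], rfl, .of_rel (.short true)⟩,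
    ⟨[(1, false), (1, false), (1, false)], rfl, .of_rel (.short false)⟩⟩

theorem mk_exponents_mem :
    FreeGroup.mk ((exponents true).flatMap fun e => [((0 : Fin 2), true), (1, e)]) ∈
      fillableSubgroup IsRelator := by
  refine ⟨⟨_, rfl, .of_rel (.long true)⟩, ?_⟩
  set v := (exponents true).flatMap fun e => [((0 : Fin 2), true), (1, e)]
  refine ⟨(0, true) :: (0, false) :: FreeGroup.invRev v, ?_, ?_⟩
  · rw [FreeGroup.inv_mk]
    exact Quot.sound (.not (L₁ := []))
  · have h : ((0, true) :: (0, false) :: FreeGroup.invRev v).map toLetter =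
        [none] ++ longRelator false ++ [none] := by decide
    rw [h]
    exact .rel _ _ _ (.long false) (.cancel [] [] none .nil)

theorem W9_sq_mem : W9 ^ 2 ∈ fillableSubgroup IsRelator := by
  rw [← QuotientGroup.eq_one_iff]
  have hy : ((y : F ⧸ fillableSubgroup IsRelator)) ^ 3 = 1 :=
    (QuotientGroup.eq_one_iff _).2 y_cube_mem
  have hy' : (y : F ⧸ fillableSubgroup IsRelator) ^ 2 = (y : F ⧸ fillableSubgroup IsRelator)⁻¹ :=
    eq_inv_of_mul_eq_one_left (by rw [← hy, pow_succ _ 2])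
  have h := (QuotientGroup.eq_one_iff _).2 mk_exponents_mem
  rw [← h]
  have h2 : FreeGroup.mk ((exponents true).flatMap fun e => [((0 : Fin 2), true), (1, e)]) =
      ((exponents true).map fun e => x * cond e y y⁻¹).prod := by
    rfl
  rw [h2]
  simp only [W9, QuotientGroup.mk_mul, QuotientGroup.mk_pow, hy', exponents, List.map_cons,
    List.map_nil, List.prod_cons, List.prod_nil, cond_true, cond_false, QuotientGroup.mk_inv,
    mul_one]
  simp only [pow_succ, pow_zero, one_mul, mul_assoc]

theorem IsFillable.of_mk_eq_one {g : F} (hg : mk W9 g = 1) : IsFillable IsRelator g := by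
  have h : Subgroup.normalClosure (rels W9) ≤ fillableSubgroup IsRelator := by
    refine Subgroup.normalClosure_le_normal ?_
    rintro g (rfl | rfl | rfl)
    · exact x_sq_mem
    · exact y_cube_mem
    · exact W9_sq_mem
  exact (h ((QuotientGroup.eq_one_iff g).1 hg)).1

/-- The product of the words `(x y x y⁻¹ x) y ^ e`, with exponents given by `E`. -/
def mixedWord (E : List Bool) : List (Fin 2 × Bool) :=
  E.flatMap fun e => [(0, true), (1, true), (0, true), (1, false), (0, true), (1, e)]

theorem length_mixedWord (E : List Bool) : (mixedWord E).length = 6 * E.length := by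
  simp [mixedWord, mul_comm]

theorem isReduced_mixedWord (E : List Bool) : FreeGroup.IsReduced (mixedWord E) := by
  induction E with
  | nil => exact .nil
  | cons e E ih =>
    cases E with
    | nil => simp [mixedWord, FreeGroup.IsReduced]
    | cons e' E =>
      simp only [mixedWord, FreeGroup.IsReduced, List.flatMap_cons, List.cons_append,
        List.nil_append, List.isChain_cons_cons] at ih ⊢
      simpa using ih

theorem mixedWord_getD (E : List Bool) : ∀ k < 6 * E.length,
    (((mixedWord E).map toLetter).getD k none = none ↔ k % 2 = 0) ∧
    (k % 6 = 1 → ((mixedWord E).map toLetter).getD k none = some true) ∧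
    (k % 6 = 3 → ((mixedWord E).map toLetter).getD k none = some false) := by
  induction E with
  | nil => simp
  | cons e E ih =>
    intro k hk
    have h : (mixedWord (e :: E)).map toLetter =
        [none, some true, none, some false, none, some e] ++ (mixedWord E).map toLetter := by
      simp [mixedWord, toLetter]
    rw [h]
    rcases lt_or_ge k 6 with h6 | h6
    · interval_cases k <;> simp
    · obtain ⟨k, rfl⟩ := Nat.exists_eq_add_of_le' h6
      rw [List.getD_append_right _ _ _ _ (by simp)]
      have := ih k (by simp at hk; omega)
      simpa [Nat.add_mod_right, show (k + 6) % 2 = k % 2 by omega] using this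

theorem isMixed_mixedWord {E : List Bool} (hE : E ≠ []) :
    IsMixed ((mixedWord E).map toLetter) := by
  have hl : ((mixedWord E).map toLetter).length = 6 * E.length := by
    rw [List.length_map, length_mixedWord]
  have hpos := List.length_pos_of_ne_nil hE
  refine ⟨⟨by omega, fun k hk => (mixedWord_getD E k (hl ▸ hk)).1⟩, ?_, fun k e => ?_⟩
  · exact List.ne_nil_of_length_pos (by omega)
  · have key : ∀ t, (k + t) % (6 * E.length) < 6 * E.length ∧
        (k + t) % (6 * E.length) % 6 = (k + t) % 6 := fun t =>
      ⟨Nat.mod_lt _ (by omega), Nat.mod_mod_of_dvd _ ⟨_, rfl⟩⟩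
    rw [hl]
    cases e with
    | true =>
      refine ⟨(7 - k % 6) % 6, Nat.mod_lt _ (by norm_num), ?_⟩
      exact (mixedWord_getD E _ (key _).1).2.1 (by rw [(key _).2]; omega)
    | false =>
      refine ⟨(9 - k % 6) % 6, Nat.mod_lt _ (by norm_num), ?_⟩
      exact (mixedWord_getD E _ (key _).1).2.2 (by rw [(key _).2]; omega)

theorem mk_mixedWord_ne_one {E : List Bool} (hE : E ≠ []) :
    mk W9 (FreeGroup.mk (mixedWord E)) ≠ 1 := by
  intro h
  obtain ⟨L₀, h₀, hP⟩ := IsFillable.of_mk_eq_one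
    (g := (FreeGroup.mk (mixedWord E))⁻¹) (by rw [map_inv, h, inv_one])
  obtain ⟨ℓ, α, O, fs, hs, hO, hfs⟩ := exists_diagram (isReduced_mixedWord E) h₀ hP
  exact not_isSpherical _ le_rfl (hO ▸ isMixed_mixedWord hE) hfs hs

section FreeSubgroup

variable {G : Type*} [Group G] (c y : G)

/-- The images of the free generators. -/
def freeGenerators : Fin 2 → G := ![c * y * c * y⁻¹, c * y⁻¹ * c * y]

/-- The product of the elements `c * y ^ e`, with exponents given by `E`. -/
def mixedProd (E : List Bool) : G := (E.map fun e => c * cond e y y⁻¹).prod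

/-- An initial factor of the image of a letter. -/
def leftFactor (l : Fin 2 × Bool) : G :=
  cond l.2 c 1 * if l.1 = 0 then y else y⁻¹

variable {c y}

theorem exists_leftFactor_mul (hc : c * c = 1) (hy : y ^ 3 = 1) {l l' : Fin 2 × Bool}
    (h : l.1 = l'.1 → l.2 = l'.2) :
    ∃ E ≠ [], (leftFactor c y l)⁻¹ * FreeGroup.lift (freeGenerators c y) (FreeGroup.mk [l]) *
      leftFactor c y l' = mixedProd c y E := by
  have hc' : c⁻¹ = c := inv_eq_of_mul_eq_one_left hc
  have hy1 : y * y = y⁻¹ := eq_inv_of_mul_eq_one_left (by rw [← hy, pow_succ, pow_two])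
  have hy2 : y⁻¹ * y⁻¹ = y := by rw [← mul_inv_rev, hy1, inv_inv]
  have hcc : ∀ g, c * (c * g) = g := fun g => by rw [← mul_assoc, hc, one_mul]
  obtain ⟨i, s⟩ := l
  obtain ⟨i', s'⟩ := l'
  refine ⟨if s = s' then [!decide (i = 0), decide (i' = 0)] else [decide (i = 0)], ?_, ?_⟩
  · split <;> simp
  · fin_cases i <;> fin_cases i' <;> cases s <;> cases s' <;>
      simp_all [leftFactor, freeGenerators, mixedProd, mul_assoc]

theorem exists_leftFactor_mul_of_isReduced (hc : c * c = 1) (hy : y ^ 3 = 1) {l' : Fin 2 × Bool}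
    (L : List (Fin 2 × Bool)) : ∀ l : Fin 2 × Bool, FreeGroup.IsReduced (l :: L ++ [l']) →
    ∃ E ≠ [], (leftFactor c y l)⁻¹ *
      FreeGroup.lift (freeGenerators c y) (FreeGroup.mk (l :: L)) * leftFactor c y l' =
        mixedProd c y E := by
  induction L with
  | nil =>
    intro l h
    exact exists_leftFactor_mul hc hy (by simpa [FreeGroup.IsReduced] using h)
  | cons l₁ L ih =>
    intro l h
    obtain ⟨h₁, h₂⟩ := List.isChain_cons_cons.1 h
    obtain ⟨E₁, hE₁, e₁⟩ := exists_leftFactor_mul hc hy h₁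
    obtain ⟨E₂, -, e₂⟩ := ih l₁ h₂
    refine ⟨E₁ ++ E₂, by simp [hE₁], ?_⟩
    have e : mixedProd c y (E₁ ++ E₂) = mixedProd c y E₁ * mixedProd c y E₂ := by
      simp [mixedProd]
    have e' : (FreeGroup.mk (l :: l₁ :: L)) = FreeGroup.mk [l] * FreeGroup.mk (l₁ :: L) := rfl
    rw [e, e', ← e₁, ← e₂, map_mul]
    group

theorem lift_freeGenerators_injective (hc : c * c = 1) (hy : y ^ 3 = 1)
    (h : ∀ E ≠ [], mixedProd c y E ≠ 1) :
    Function.Injective (FreeGroup.lift (freeGenerators c y)) := by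
  rw [injective_iff_map_eq_one]
  intro g hg
  have hr := FreeGroup.reduceCyclically.isCyclicallyReduced (FreeGroup.isReduced_toWord (x := g))
  have hw := congrArg FreeGroup.mk
    (FreeGroup.reduceCyclically.conj_conjugator_reduceCyclically g.toWord)
  rw [FreeGroup.mk_toWord, ← FreeGroup.mul_mk, ← FreeGroup.mul_mk, ← FreeGroup.inv_mk] at hw
  rcases hR : FreeGroup.reduceCyclically g.toWord with _ | ⟨l, L⟩
  · rw [hR] at hw
    rw [← hw]
    exact conj_eq_one_iff.2 rfl
  · rw [hR] at hw hr
    obtain ⟨E, hE, e⟩ := exists_leftFactor_mul_of_isReduced hc hy (l' := l) L l (by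
      refine List.isChain_append.2 ⟨hr.1, by simp, fun a ha b hb => ?_⟩
      exact hr.2 a ha b (by simpa using hb))
    refine absurd ?_ (h E hE)
    rw [← hw, map_mul, map_mul, map_inv, conj_eq_one_iff] at hg
    rw [← e, hg, mul_one, inv_mul_cancel]

end FreeSubgroup

theorem mk_mixedWord (E : List Bool) : mk W9 (FreeGroup.mk (mixedWord E)) =
    mixedProd (mk W9 (x * y * x * y⁻¹ * x)) (mk W9 y) E := by
  induction E with
  | nil => rfl
  | cons e E ih =>
    have h : FreeGroup.mk (mixedWord (e :: E)) =
        x * y * x * y⁻¹ * x * cond e y y⁻¹ * FreeGroup.mk (mixedWord E) := by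
      cases e <;> rfl
    rw [h, map_mul, map_mul, ih, mixedProd, mixedProd, List.map_cons, List.prod_cons]
    cases e
    · rw [cond_false, cond_false, map_inv]
    · rfl

end SmallCancellation

theorem stmt_18 :
    ∃ H : Subgroup (GT W9), Nonempty (H ≃* FreeGroup (Fin 2)) := by
  have hx : mk W9 x * mk W9 x = 1 := by
    rw [← map_mul, ← pow_two]
    exact PresentedGroup.one_of_mem (by simp [rels])
  have hy : mk W9 y ^ 3 = 1 := by
    rw [← map_pow]
    exact PresentedGroup.one_of_mem (by simp [rels])
  have hx' : ∀ g, mk W9 x * (mk W9 x * g) = g := fun g => by rw [← mul_assoc, hx, one_mul]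
  have hc : mk W9 (x * y * x * y⁻¹ * x) * mk W9 (x * y * x * y⁻¹ * x) = 1 := by
    simp [mul_assoc, hx, hx']
  have hinj := SmallCancellation.lift_freeGenerators_injective hc hy fun E hE => by
    rw [← SmallCancellation.mk_mixedWord]
    exact SmallCancellation.mk_mixedWord_ne_one hE
  exact ⟨_, ⟨(MonoidHom.ofInjective hinj).symm⟩⟩
end
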